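/- arXiv:1502.04784 — 4 statements merged into one kernel-verified Lean document; each statement's English description precedes it below -/
import Mathlib

section
/- Let p be a prime and let G be a finite abelian p-group. Then the partially ordered set Iso(G) is a distributive lattice: there exists a distributive lattice structure on Iso(G) whose underlying partial order coincides with the order of Iso(G). -/
/-- The setoid on subgroups of `G` given by group isomorphism. -/
def isoSetoid (G : Type*) [Group G] : Setoid (Subgroup G) where
  r H K := Nonempty (H ≃* K)
  iseqv := ⟨fun H => ⟨MulEquiv.refl H⟩, fun ⟨e⟩ => ⟨e.symm⟩, fun ⟨e⟩ ⟨f⟩ => ⟨e.trans f⟩⟩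

/-- `IsoClasses G` is the set of equivalence classes of subgroups of `G`
under group isomorphism. -/
def IsoClasses (G : Type*) [Group G] : Type _ := Quotient (isoSetoid G)

/-- The class of a subgroup `H` in `IsoClasses G`. -/
def IsoCls {G : Type*} [Group G] (H : Subgroup G) : IsoClasses G :=
  Quotient.mk (isoSetoid G) H

/-- `[H] ≤ [K]` iff some member of `[H]` is contained in some member of `[K]`. -/
instance instLEIsoClasses (G : Type*) [Group G] : LE (IsoClasses G) where
  le x y := ∃ H K : Subgroup G, IsoCls H = x ∧ IsoCls K = y ∧ H ≤ K


/-- The number of cyclic factors of order greater than `p ^ k` in a finite abelian `p`-group `A`,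
read off from the elements of order dividing `p` that are `p ^ k`-th powers. -/
noncomputable def powRank (p : ℕ) (A : Type*) [Group A] (k : ℕ) : ℕ :=
  Nat.log p (Nat.card {x : A // x ^ p = 1 ∧ ∃ y : A, y ^ p ^ k = x})

theorem powRank_mono {p : ℕ} {A B : Type*} [Group A] [Group B] [Finite B] (f : A →* B)
    (hf : Function.Injective f) (k : ℕ) : powRank p A k ≤ powRank p B k := by
  refine Nat.log_mono_right (Nat.card_le_card_of_injective
    (fun x => ⟨f x.1, by rw [← map_pow, x.2.1, map_one], ?_⟩) fun x y h => ?_)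
  · obtain ⟨y, hy⟩ := x.2.2
    exact ⟨f y, by rw [← map_pow, hy]⟩
  · exact Subtype.ext (hf (congrArg Subtype.val h))

theorem powRank_congr {p : ℕ} {A B : Type*} [Group A] [Group B] [Finite A] [Finite B]
    (f : A ≃* B) (k : ℕ) : powRank p A k = powRank p B k :=
  (powRank_mono f.toMonoidHom f.injective k).antisymm
    (powRank_mono f.symm.toMonoidHom f.symm.injective k)

theorem powRank_antitone {p : ℕ} {A : Type*} [Group A] [Finite A] :
    Antitone (powRank p A) := by
  intro k l hkl
  refine Nat.log_mono_right (Nat.card_le_card_of_injective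
    (fun x => ⟨x.1, x.2.1, ?_⟩) fun x y h => ?_)
  · obtain ⟨y, hy⟩ := x.2.2
    exact ⟨y ^ p ^ (l - k), by rw [← pow_mul, ← pow_add, Nat.sub_add_cancel hkl, hy]⟩
  · exact Subtype.ext (Subtype.mk.inj h)

theorem card_pow_eq_one_and_isPow_of_cyclic {p : ℕ} (hp : p.Prime) {A : Type*} [CommGroup A]
    [IsCyclic A] [Finite A] {e : ℕ} (hA : Nat.card A = p ^ e) (k : ℕ) :
    Nat.card {x : A // x ^ p = 1 ∧ ∃ y : A, y ^ p ^ k = x} = if k < e then p else 1 := by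
  let R := (powMonoidHom (α := A) (p ^ k)).range
  have hR : Nat.card R = p ^ e / (p ^ e).gcd (p ^ k) := by
    rw [IsCyclic.card_powMonoidHom_range, hA]
  let φ : {x : A // x ^ p = 1 ∧ ∃ y : A, y ^ p ^ k = x} ≃ (powMonoidHom (α := R) p).ker :=
    { toFun := fun x => ⟨⟨x.1, x.2.2⟩, Subtype.ext x.2.1⟩
      invFun := fun x => ⟨x.1.1, congrArg Subtype.val x.2, x.1.2⟩
      left_inv := fun _ => rfl
      right_inv := fun _ => rfl }
  rw [Nat.card_congr φ, IsCyclic.card_powMonoidHom_ker, hR]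
  split_ifs with h
  · rw [Nat.gcd_eq_right (pow_dvd_pow p h.le), Nat.pow_div h.le hp.pos]
    exact Nat.gcd_eq_right (dvd_pow_self p (Nat.sub_ne_zero_of_lt h))
  · rw [Nat.gcd_eq_left (pow_dvd_pow p (not_lt.1 h)), Nat.div_self (pow_pos hp.pos e),
      Nat.gcd_one_left]

/-- The product of the cyclic groups of order `p ^ e i`. -/
abbrev PrimePowerProd (p : ℕ) {ι : Type*} (e : ι → ℕ) : Type _ :=
  ∀ i, Multiplicative (ZMod (p ^ e i))

theorem finite_primePowerProd {p : ℕ} (hp : p.Prime) {ι : Type*} [Finite ι] (e : ι → ℕ) :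
    Finite (PrimePowerProd p e) := by
  have (i : ι) : NeZero (p ^ e i) := ⟨pow_ne_zero _ hp.ne_zero⟩
  infer_instance

theorem powRank_primePowerProd {p : ℕ} (hp : p.Prime) {ι : Type*} [Fintype ι] (e : ι → ℕ)
    (k : ℕ) : powRank p (PrimePowerProd p e) k = Finset.card {i | k < e i} := by
  have hne (i : ι) : NeZero (p ^ e i) := ⟨pow_ne_zero _ hp.ne_zero⟩
  let φ : {x : PrimePowerProd p e // x ^ p = 1 ∧ ∃ y : PrimePowerProd p e, y ^ p ^ k = x} ≃
      ∀ i, {x : Multiplicative (ZMod (p ^ e i)) //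
        x ^ p = 1 ∧ ∃ y : Multiplicative (ZMod (p ^ e i)), y ^ p ^ k = x} :=
    { toFun := fun x i => ⟨x.1 i, congrFun x.2.1 i, 
        x.2.2.choose i, congrFun x.2.2.choose_spec i⟩
      invFun := fun x => ⟨fun i => (x i).1, funext fun i => (x i).2.1,
        fun i => (x i).2.2.choose, funext fun i => (x i).2.2.choose_spec⟩
      left_inv := fun _ => rfl
      right_inv := fun _ => rfl }
  rw [powRank, Nat.card_congr φ, Nat.card_pi, Finset.prod_congr rfl fun i _ =>
    card_pow_eq_one_and_isPow_of_cyclic hp (e := e i) (by simp) k, Finset.prod_ite]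
  simp [Nat.log_pow hp.one_lt]

theorem exists_injective_zmod_pow {p a b : ℕ} (hp : p.Prime) (hab : a ≤ b) :
    ∃ f : Multiplicative (ZMod (p ^ a)) →* Multiplicative (ZMod (p ^ b)),
      Function.Injective f := by
  have hpow : p ^ b = p ^ a * p ^ (b - a) := by rw [← pow_add, Nat.add_sub_cancel' hab]
  let g : ℤ →+ ZMod (p ^ b) :=
    (Int.castAddHom (ZMod (p ^ b))).comp (AddMonoidHom.mulRight ((p ^ (b - a) : ℕ) : ℤ))
  have hg (m : ℤ) : g m = 0 ↔ ((p ^ a : ℕ) : ℤ) ∣ m := by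
    have hne : ((p ^ (b - a) : ℕ) : ℤ) ≠ 0 := by exact_mod_cast pow_ne_zero _ hp.ne_zero
    change ((m * ((p ^ (b - a) : ℕ) : ℤ) : ℤ) : ZMod (p ^ b)) = 0 ↔ _
    rw [ZMod.intCast_zmod_eq_zero_iff_dvd, hpow, Nat.cast_mul, mul_dvd_mul_iff_right hne]
  refine ⟨AddMonoidHom.toMultiplicative (ZMod.lift (p ^ a) ⟨g, (hg _).2 dvd_rfl⟩), ?_⟩
  exact (ZMod.lift_injective (p ^ a) (f := ⟨g, (hg _).2 dvd_rfl⟩)).2 fun m hm =>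
    (ZMod.intCast_zmod_eq_zero_iff_dvd _ _).2 ((hg m).1 hm)

theorem exists_injective_primePowerProd {p : ℕ} (hp : p.Prime) {ι κ : Type*} [Fintype ι]
    (e : ι → ℕ) (f : κ → ℕ) (σ : ι → κ) (hσ : Function.Injective σ)
    (hef : ∀ i, e i ≤ f (σ i)) :
    ∃ φ : PrimePowerProd p e →* PrimePowerProd p f, Function.Injective φ := by
  classical
  choose g hg using fun i => exists_injective_zmod_pow hp (hef i)
  let φ : PrimePowerProd p e →* PrimePowerProd p f := ∏ i,
    ((MonoidHom.mulSingle (fun j => Multiplicative (ZMod (p ^ f j))) (σ i)).comp (g i)).comp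
      (Pi.evalMonoidHom (fun i => Multiplicative (ZMod (p ^ e i))) i)
  have hφ (x : PrimePowerProd p e) (i : ι) : φ x (σ i) = g i (x i) := by
    simp only [φ, MonoidHom.finsetProd_apply, Finset.prod_apply]
    rw [Finset.prod_eq_single i]
    · simp
    · intro j _ hj
      simp [Pi.mulSingle_eq_of_ne (hσ.ne hj.symm)]
    · simp
  exact ⟨φ, fun x y h => funext fun i => hg i (by rw [← hφ, ← hφ, h])⟩

/-- Domination of the tail counts of `e` by those of `f` gives a matching of `e` into `f`. -/
theorem exists_injective_le_of_card_le {ι κ : Type*} [Fintype ι] [Fintype κ] (e : ι → ℕ)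
    (f : κ → ℕ) (he : ∀ i, 0 < e i)
    (h : ∀ k, Finset.card {i | k < e i} ≤ Finset.card {j | k < f j}) :
    ∃ σ : ι → κ, Function.Injective σ ∧ ∀ i, e i ≤ f (σ i) := by
  classical
  obtain ⟨σ, hσ, hm⟩ := (Finset.all_card_le_biUnion_card_iff_exists_injective
    fun i : ι => ({j | e i ≤ f j} : Finset κ)).1 fun s => by
      rcases s.eq_empty_or_nonempty with rfl | hs
      · simp
      obtain ⟨i, his, hi⟩ := s.exists_min_image e hs
      calc s.card ≤ Finset.card {j | e i - 1 < e j} := Finset.card_le_card fun j hj => by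
            have := hi j hj
            have := he i
            simp only [Finset.mem_filter_univ]
            omega
        _ ≤ Finset.card {j | e i - 1 < f j} := h _
        _ ≤ _ := Finset.card_le_card fun j hj => by
            simp only [Finset.mem_filter_univ] at hj
            exact Finset.mem_biUnion.2 ⟨i, his, by simp only [Finset.mem_filter_univ]; omega⟩
  exact ⟨σ, hσ, fun i => by simpa using hm i⟩

theorem IsPGroup.exists_mulEquiv_primePowerProd {p : ℕ} (hp : p.Prime) {A : Type*} [CommGroup A]
    [Finite A] (hA : IsPGroup p A) :
    ∃ (ι : Type) (_ : Fintype ι) (e : ι → ℕ),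
      (∀ i, 0 < e i) ∧ Nonempty (A ≃* PrimePowerProd p e) := by
  classical
  obtain ⟨ι, _, n, hn, ⟨φ⟩⟩ := CommGroup.equiv_prod_multiplicative_zmod_of_finite A
  have : Fact p.Prime := ⟨hp⟩
  have hpow (i : ι) : ∃ e, n i = p ^ e := by
    have : NeZero (n i) := ⟨(zero_lt_one.trans (hn i)).ne'⟩
    have h := (hA.of_equiv φ).of_injective
      (MonoidHom.mulSingle (fun j => Multiplicative (ZMod (n j))) i)
      (Pi.mulSingle_injective (M := fun j => Multiplicative (ZMod (n j))) i)
    obtain ⟨e, he⟩ := IsPGroup.iff_card.1 h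
    exact ⟨e, by simpa using he⟩
  choose e he using hpow
  obtain rfl : n = fun i => p ^ e i := funext he
  exact ⟨ι, ‹_›, e, fun i => Nat.pos_of_ne_zero fun h => by simpa [h] using hn i, ⟨φ⟩⟩

/-- Finite abelian `p`-groups embed into each other exactly as their `powRank`s dictate. -/
theorem IsPGroup.exists_injective_iff_powRank_le {p : ℕ} (hp : p.Prime) {A B : Type*}
    [CommGroup A] [CommGroup B] [Finite A] [Finite B] (hA : IsPGroup p A) (hB : IsPGroup p B) :
    (∃ f : A →* B, Function.Injective f) ↔ powRank p A ≤ powRank p B := by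
  refine ⟨fun ⟨f, hf⟩ => powRank_mono f hf, fun h => ?_⟩
  obtain ⟨ι, _, e, he, ⟨φ⟩⟩ := hA.exists_mulEquiv_primePowerProd hp
  obtain ⟨κ, _, f, -, ⟨ψ⟩⟩ := hB.exists_mulEquiv_primePowerProd hp
  have := finite_primePowerProd hp e
  have := finite_primePowerProd hp f
  obtain ⟨σ, hσ, hle⟩ := exists_injective_le_of_card_le e f he fun k => by
    rw [← powRank_primePowerProd hp, ← powRank_primePowerProd hp, ← powRank_congr φ,
      ← powRank_congr ψ]
    exact h k
  obtain ⟨g, hg⟩ := exists_injective_primePowerProd hp e f σ hσ hle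
  exact ⟨(ψ.symm.toMonoidHom.comp g).comp φ.toMonoidHom,
    (ψ.symm.injective.comp hg).comp φ.injective⟩

theorem IsPGroup.nonempty_mulEquiv_iff_powRank_eq {p : ℕ} (hp : p.Prime) {A B : Type*}
    [CommGroup A] [CommGroup B] [Finite A] [Finite B] (hA : IsPGroup p A) (hB : IsPGroup p B) :
    Nonempty (A ≃* B) ↔ powRank p A = powRank p B := by
  refine ⟨fun ⟨f⟩ => funext (powRank_congr f), fun h => ?_⟩
  obtain ⟨f, hf⟩ := (hA.exists_injective_iff_powRank_le hp hB).2 h.le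
  obtain ⟨g, hg⟩ := (hB.exists_injective_iff_powRank_le hp hA).2 h.ge
  have hcard := (Nat.card_le_card_of_injective f hf).antisymm (Nat.card_le_card_of_injective g hg)
  exact ⟨MulEquiv.ofBijective f ((Nat.bijective_iff_injective_and_card f).2 ⟨hf, hcard⟩)⟩

theorem IsPGroup.exists_powRank_eq_zero {p : ℕ} (hp : p.Prime) {A : Type*} [Group A] [Finite A]
    (hA : IsPGroup p A) : ∃ N, powRank p A N = 0 := by
  have : Fact p.Prime := ⟨hp⟩
  obtain ⟨N, hN⟩ := IsPGroup.iff_card.1 hA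
  refine ⟨N, Nat.log_of_lt ?_⟩
  have : Subsingleton {x : A // x ^ p = 1 ∧ ∃ y : A, y ^ p ^ N = x} := ⟨by
    rintro ⟨_, -, y, rfl⟩ ⟨_, -, z, rfl⟩
    simp [← hN]⟩
  exact (Finite.card_le_one_iff_subsingleton.2 this).trans_lt hp.one_lt

/-- Every antitone sequence below the `powRank` of `G` is the `powRank` of a subgroup. -/
theorem IsPGroup.exists_subgroup_powRank_eq {p : ℕ} (hp : p.Prime) {G : Type*} [CommGroup G]
    [Finite G] (hG : IsPGroup p G) {r : ℕ → ℕ} (hr : Antitone r) (hrG : r ≤ powRank p G) :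
    ∃ H : Subgroup G, powRank p H = r := by
  obtain ⟨N, hN⟩ := hG.exists_powRank_eq_zero hp
  have hrN : r N = 0 := Nat.le_zero.1 (hN ▸ hrG N)
  let e (i : Fin (r 0)) : ℕ := Nat.find (⟨N, by omega⟩ : ∃ k, r k ≤ i)
  have hlt (i : Fin (r 0)) (k : ℕ) : k < e i ↔ i < r k := by
    rw [Nat.lt_find_iff]
    exact ⟨fun h => not_le.1 (h k le_rfl), fun h m hm => not_le.2 (h.trans_le (hr hm))⟩
  have hrank : powRank p (PrimePowerProd p e) = r := by
    funext k
    rw [powRank_primePowerProd hp]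
    simp only [hlt]
    rw [Fin.card_filter_val_lt, min_eq_right (hr k.zero_le)]
  have := finite_primePowerProd hp e
  have : Fact p.Prime := ⟨hp⟩
  have hA : IsPGroup p (PrimePowerProd p e) :=
    IsPGroup.iff_card.2 ⟨∑ i, e i, by simp [Finset.prod_pow_eq_pow_sum]⟩
  obtain ⟨f, hf⟩ := (hA.exists_injective_iff_powRank_le hp hG).2 (hrank.trans_le hrG)
  exact ⟨f.range, (funext (powRank_congr (f.ofInjective hf).symm)).trans hrank⟩

theorem isoCls_le_isoCls_iff {G : Type*} [Group G] (H K : Subgroup G) :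
    IsoCls H ≤ IsoCls K ↔ ∃ f : H →* K, Function.Injective f := by
  constructor
  · rintro ⟨H', K', hH, hK, hle⟩
    obtain ⟨φ⟩ : Nonempty (H' ≃* H) := Quotient.exact hH
    obtain ⟨ψ⟩ : Nonempty (K' ≃* K) := Quotient.exact hK
    exact ⟨(ψ.toMonoidHom.comp (Subgroup.inclusion hle)).comp φ.symm.toMonoidHom,
      (ψ.injective.comp (Subgroup.inclusion_injective hle)).comp φ.symm.injective⟩
  · rintro ⟨f, hf⟩
    refine ⟨(K.subtype.comp f).range, K, Quotient.sound ?_, rfl, ?_⟩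
    · exact ⟨((K.subtype.comp f).ofInjective (K.subtype_injective.comp hf)).symm⟩
    · rintro _ ⟨x, rfl⟩
      exact (f x).2

/-- The `powRank` sequence of an isomorphism class of subgroups. -/
noncomputable def IsoClasses.rank (p : ℕ) {G : Type*} [Group G] [Finite G] :
    IsoClasses G → ℕ → ℕ :=
  Quotient.lift (fun H : Subgroup G => powRank p H) fun _ _ ⟨f⟩ => funext (powRank_congr f)

section

variable {p : ℕ} {G : Type*} [CommGroup G] [Finite G]

theorem IsoClasses.rank_le_rank_iff (hp : p.Prime) (hG : IsPGroup p G) (x y : IsoClasses G) :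
    x.rank p ≤ y.rank p ↔ x ≤ y := by
  induction x using Quotient.inductionOn with | _ H =>
  induction y using Quotient.inductionOn with | _ K =>
  exact (((hG.to_subgroup H).exists_injective_iff_powRank_le hp (hG.to_subgroup K)).symm).trans
    (isoCls_le_isoCls_iff H K).symm

theorem IsoClasses.rank_injective (hp : p.Prime) (hG : IsPGroup p G) :
    Function.Injective (IsoClasses.rank p (G := G)) := by
  intro x y h
  induction x using Quotient.inductionOn with | _ H =>
  induction y using Quotient.inductionOn with | _ K =>
  exact Quotient.sound
    (((hG.to_subgroup H).nonempty_mulEquiv_iff_powRank_eq hp (hG.to_subgroup K)).2 h)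

theorem IsoClasses.mem_range_rank_iff (hp : p.Prime) (hG : IsPGroup p G) (r : ℕ → ℕ) :
    r ∈ Set.range (IsoClasses.rank p (G := G)) ↔ Antitone r ∧ r ≤ powRank p G := by
  constructor
  · rintro ⟨x, rfl⟩
    induction x using Quotient.inductionOn with | _ H =>
    exact ⟨powRank_antitone, powRank_mono H.subtype H.subtype_injective⟩
  · rintro ⟨hr, hrG⟩
    obtain ⟨H, hH⟩ := hG.exists_subgroup_powRank_eq hp hr hrG
    exact ⟨IsoCls H, hH⟩

end

/-- For a finite abelian `p`-group `G`, the poset `IsoClasses G` is a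
distributive lattice: there is a distributive lattice structure on `IsoClasses G` whose
underlying partial order coincides with the order of `IsoClasses G`. -/
theorem isoClasses_distribLattice_of_abelian_pGroup (p : ℕ) (hp : p.Prime)
    (G : Type*) [CommGroup G] [Finite G] (hG : IsPGroup p G) :
    ∃ L : DistribLattice (IsoClasses G),
      ∀ x y : IsoClasses G, L.le x y ↔ x ≤ y := by
  let S : Sublattice (ℕ → ℕ) :=
    { carrier := Set.range (IsoClasses.rank p (G := G))
      supClosed' := fun r hr s hs => by
        rw [IsoClasses.mem_range_rank_iff hp hG] at *
        exact ⟨hr.1.sup hs.1, sup_le hr.2 hs.2⟩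
      infClosed' := fun r hr s hs => by
        rw [IsoClasses.mem_range_rank_iff hp hG] at *
        exact ⟨hr.1.inf hs.1, inf_le_left.trans hr.2⟩ }
  let φ : IsoClasses G ≃ S := Equiv.ofInjective _ (IsoClasses.rank_injective hp hG)
  exact ⟨φ.distribLattice, fun x y => IsoClasses.rank_le_rank_iff hp hG x y⟩
end

section
/- Let G be a finite group of order n all of whose Sylow subgroups are cyclic (a ZM-group). Then the map sending the class [H] to the order |H| is an order isomorphism from Iso(G) onto the lattice of divisors of n ordered by divisibility. In particular, two subgroups of G are isomorphic iff they have the same order, and [H] ≤ [K] in Iso(G) iff |H| divides |K|. -/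
namespace IsCyclic

theorem subgroup_eq_of_card_eq {C : Type*} [Group C] [Finite C] [IsCyclic C] {H K : Subgroup C}
    (h : Nat.card H = Nat.card K) : H = K := by
  classical
  have := Fintype.ofFinite C
  have key (L : Subgroup C) : (L : Set C) = {x : C | x ^ Nat.card L = 1} := by
    refine Set.eq_of_subset_of_ncard_le
      (fun x hx ↦ orderOf_dvd_iff_pow_eq_one.mp (L.orderOf_dvd_natCard hx)) ?_
      (Set.toFinite _)
    have hle := IsCyclic.card_pow_eq_one_le (α := C) (n := Nat.card L) Nat.card_pos
    rw [show (L : Set C).ncard = Nat.card L from rfl, Set.ncard_eq_toFinset_card']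
    convert hle
    simp
  exact SetLike.coe_injective ((key H).trans (h ▸ (key K).symm))

theorem exists_subgroup_card_eq {C : Type*} [Group C] [Finite C] [IsCyclic C] {d : ℕ}
    (hd : d ∣ Nat.card C) : ∃ H : Subgroup C, Nat.card H = d := by
  obtain ⟨g, hg⟩ := IsCyclic.exists_ofOrder_eq_natCard (α := C)
  obtain ⟨m, hm⟩ := hd
  have hpos : 0 < Nat.card C := Nat.card_pos
  have hm0 : m ≠ 0 := by rintro rfl; simp_all
  refine ⟨Subgroup.zpowers (g ^ m), ?_⟩
  rw [Nat.card_zpowers, orderOf_pow_of_dvd hm0 (hg ▸ hm ▸ dvd_mul_left m d), hg, hm,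
    Nat.mul_div_cancel _ (Nat.pos_of_ne_zero hm0)]

theorem characteristic {C : Type*} [Group C] [Finite C] [IsCyclic C] (H : Subgroup C) :
    H.Characteristic :=
  Subgroup.characteristic_iff_map_eq.mpr fun ϕ ↦ subgroup_eq_of_card_eq
    (Subgroup.card_map_of_injective ϕ.injective)

end IsCyclic

namespace Subgroup

variable {G : Type*} [Group G]

theorem exists_card_eq_mul_of_disjoint {N C : Subgroup G} [N.Normal] (h : Disjoint N C) :
    ∃ H : Subgroup G, Nat.card H = Nat.card N * Nat.card C := by
  let f := SemidirectProduct.monoidHomSubgroup (H := N) (K := C) (N.normalizer_eq_top ▸ le_top)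
  have hf : Function.Injective f := fun x y hxy ↦ by
    have := @mul_injective_of_disjoint G _ N C h (x.left, x.right) (y.left, y.right) hxy
    rw [Prod.mk.injEq] at this
    exact SemidirectProduct.ext this.1 this.2
  refine ⟨f.range, ?_⟩
  rw [← Nat.card_congr (MonoidHom.ofInjective hf).toEquiv, SemidirectProduct.card]

theorem card_subgroupOf_dvd (A H : Subgroup G) : Nat.card (A.subgroupOf H) ∣ Nat.card A :=
  card_comap_dvd_of_injective A H.subtype H.subtype_injective

variable [Finite G] {A : Subgroup G} [A.Normal]

/-- In a finite group with a cyclic normal Hall subgroup `A` whose quotient is cyclic, subgroups of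
the same order are isomorphic. -/
theorem nonempty_mulEquiv_of_card_eq [IsCyclic A] [IsCyclic (G ⧸ A)]
    (hA : (Nat.card A).Coprime A.index) {H K : Subgroup G} (h : Nat.card H = Nat.card K) :
    Nonempty (H ≃* K) := by
  have hmul (L : Subgroup G) : Nat.card (A.subgroupOf L) * A.relIndex L = Nat.card L :=
    card_mul_index _
  have hcop (L M : Subgroup G) : (Nat.card (A.subgroupOf L)).Coprime (A.relIndex M) :=
    hA.of_dvd (card_subgroupOf_dvd A L) (relIndex_dvd_index_of_normal A M)
  have hcard : Nat.card (A.subgroupOf H) = Nat.card (A.subgroupOf K) := by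
    refine Nat.dvd_antisymm ((hcop H K).dvd_of_dvd_mul_right ?_)
      ((hcop K H).dvd_of_dvd_mul_right ?_)
    · exact hmul K ▸ h ▸ card_subgroup_dvd_card _
    · exact hmul H ▸ h ▸ card_subgroup_dvd_card _
  have hindex : A.relIndex H = A.relIndex K :=
    Nat.eq_of_mul_eq_mul_left Nat.card_pos (((hmul H).trans h).trans (hcard ▸ (hmul K).symm))
  have hinf : A ⊓ H = A ⊓ K := by
    have := IsCyclic.subgroup_eq_of_card_eq (H := H.subgroupOf A) (K := K.subgroupOf A) (by
      rw [← card_map_of_injective A.subtype_injective, subgroupOf_map_subtype, inf_comm,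
        ← subgroupOf_map_subtype, card_map_of_injective H.subtype_injective, hcard,
        ← card_map_of_injective K.subtype_injective, subgroupOf_map_subtype, inf_comm,
        ← subgroupOf_map_subtype, card_map_of_injective A.subtype_injective])
    rwa [subgroupOf_inj, inf_comm, inf_comm K] at this
  have hmap : H.map (QuotientGroup.mk' A) = K.map (QuotientGroup.mk' A) :=
    IsCyclic.subgroup_eq_of_card_eq (by
      rw [← relIndex_ker, ← relIndex_ker, QuotientGroup.ker_mk', hindex])
  obtain ⟨C, hC⟩ := exists_right_complement'_of_coprime (N := A.subgroupOf H) (hcop H H)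
  obtain ⟨D, hD⟩ := exists_right_complement'_of_coprime (N := A.subgroupOf K) (hcop K K)
  -- A complement of `A ⊓ L` in `L` is isomorphic to the image of `L` in `G ⧸ A`.
  have hcompl (L : Subgroup G) (E : Subgroup L) (hE : IsComplement' (A.subgroupOf L) E) :
      ∃ e : E ≃* L.map (QuotientGroup.mk' A), ∀ x : E, (e x : G ⧸ A) = ((x : L) : G) := by
    let f : E →* L.map (QuotientGroup.mk' A) :=
      ((QuotientGroup.mk' A).subgroupMap L).comp E.subtype
    have hf : Function.Injective f := by
      rw [injective_iff_map_eq_one]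
      intro x hx
      have hxA : ((x : L) : G) ∈ A := (QuotientGroup.eq_one_iff _).mp (congrArg Subtype.val hx)
      exact Subtype.ext (disjoint_def.mp hE.disjoint (mem_subgroupOf.mpr hxA) x.2)
    refine ⟨MulEquiv.ofBijective f ((Nat.bijective_iff_injective_and_card f).mpr ⟨hf, ?_⟩),
      fun x ↦ rfl⟩
    rw [← relIndex_ker, QuotientGroup.ker_mk', relIndex, hE.symm.index_eq_card]
  obtain ⟨eC, heC⟩ := hcompl H C hC
  obtain ⟨eD, heD⟩ := hcompl K D hD
  let fg : C ≃* D := (eC.trans (MulEquiv.subgroupCongr hmap)).trans eD.symm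
  have hfg (c : C) : (((fg c : K) : G) : G ⧸ A) = ((c : H) : G) := by
    rw [← heD, ← heC]
    simp [fg]
  have hmem {x : G} (hx : x ∈ A) : x ∈ H ↔ x ∈ K := by
    simpa [hx] using SetLike.ext_iff.mp hinf x
  let fn : A.subgroupOf H ≃* A.subgroupOf K :=
    { toFun x := ⟨⟨x.1, (hmem x.2).mp x.1.2⟩, x.2⟩
      invFun x := ⟨⟨x.1, (hmem x.2).mpr x.1.2⟩, x.2⟩
      left_inv _ := rfl
      right_inv _ := rfl
      map_mul' _ _ := rfl }
  refine ⟨(SemidirectProduct.mulEquivSubgroup hC).symm.trans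
    ((SemidirectProduct.congr fn fg fun c ↦ ?_).trans (SemidirectProduct.mulEquivSubgroup hD))⟩
  ext a
  change ((c : H) : G) * ((a : H) : G) * ((c : H) : G)⁻¹ =
    ((fg c : K) : G) * ((a : H) : G) * ((fg c : K) : G)⁻¹
  have hquot : ((c : H) : G)⁻¹ * ((fg c : K) : G) ∈ A := QuotientGroup.eq.mp (hfg c).symm
  have hcomm := congrArg Subtype.val
    (IsMulCommutative.is_comm.comm (⟨_, hquot⟩ : A) ⟨((a : H) : G), a.2⟩)
  dsimp only [coe_mul] at hcomm
  rw [mul_inv_eq_iff_eq_mul]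
  calc ((c : H) : G) * ((a : H) : G)
      = (c : H) * (((a : H) : G) * (((c : H) : G)⁻¹ * ((fg c : K) : G))) *
          ((fg c : K) : G)⁻¹ * (c : H) := by group
    _ = ((fg c : K) : G) * ((a : H) : G) * ((fg c : K) : G)⁻¹ * (c : H) := by
        rw [← hcomm]; group

end Subgroup

namespace IsZGroup

variable (G : Type*) [Group G] [Finite G] [IsZGroup G]

theorem isCyclic_quotient_commutator : IsCyclic (G ⧸ commutator G) :=
  isCyclic_abelianization

variable {G}

theorem exists_subgroup_card_eq {d : ℕ} (hd : d ∣ Nat.card G) :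
    ∃ H : Subgroup G, Nat.card H = d := by
  have := isCyclic_commutator G
  have := isCyclic_quotient_commutator G
  obtain ⟨B, hB⟩ := Subgroup.exists_right_complement'_of_coprime (coprime_commutator_index G)
  have : IsCyclic B := isCyclic_of_surjective _ hB.symm.QuotientMulEquiv.surjective
  rw [← hB.card_mul_card] at hd
  obtain ⟨a, b, ha, hb, rfl⟩ := exists_dvd_and_dvd_of_dvd_mul hd
  obtain ⟨N, rfl⟩ := IsCyclic.exists_subgroup_card_eq ha
  obtain ⟨C, rfl⟩ := IsCyclic.exists_subgroup_card_eq hb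
  have := IsCyclic.characteristic N
  have hdisj : Disjoint (N.map (commutator G).subtype) (C.map B.subtype) :=
    hB.disjoint.mono (Subgroup.map_subtype_le N) (Subgroup.map_subtype_le C)
  obtain ⟨H, hH⟩ := Subgroup.exists_card_eq_mul_of_disjoint hdisj
  refine ⟨H, hH.trans ?_⟩
  rw [Subgroup.card_map_of_injective (Subgroup.subtype_injective _),
    Subgroup.card_map_of_injective (Subgroup.subtype_injective _)]

theorem nonempty_mulEquiv_iff_card_eq {H K : Subgroup G} :
    Nonempty (H ≃* K) ↔ Nat.card H = Nat.card K := by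
  have := isCyclic_commutator G
  have := isCyclic_quotient_commutator G
  exact ⟨fun ⟨e⟩ ↦ Nat.card_congr e.toEquiv,
    Subgroup.nonempty_mulEquiv_of_card_eq (coprime_commutator_index G)⟩

theorem isoCls_eq_iff {H K : Subgroup G} : IsoCls H = IsoCls K ↔ Nat.card H = Nat.card K :=
  Quotient.eq.trans nonempty_mulEquiv_iff_card_eq

theorem isoCls_le_iff {H K : Subgroup G} : IsoCls H ≤ IsoCls K ↔ Nat.card H ∣ Nat.card K := by
  constructor
  · rintro ⟨H', K', hH, hK, hle⟩
    rw [← isoCls_eq_iff.mp hH, ← isoCls_eq_iff.mp hK]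
    exact Subgroup.card_dvd_of_le hle
  · intro hd
    obtain ⟨L, hL⟩ := exists_subgroup_card_eq hd
    refine ⟨L.map K.subtype, K, isoCls_eq_iff.mpr ?_, rfl, Subgroup.map_subtype_le L⟩
    rw [Subgroup.card_map_of_injective K.subtype_injective, hL]

end IsZGroup

/-- If `G` is a finite group of order `n` all of whose Sylow subgroups are
cyclic (a ZM-group), then `[H] ↦ |H|` is an order isomorphism from `IsoClasses G` onto the
divisors of `n` ordered by divisibility; in particular two subgroups are isomorphic iff they
have the same order, and `[H] ≤ [K]` iff `|H|` divides `|K|`. -/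
theorem isoClasses_orderIso_divisors_of_ZM (G : Type*) [Group G] [Finite G]
    (hZM : ∀ (p : ℕ) [Fact p.Prime] (P : Sylow p G), IsCyclic (P : Subgroup G)) :
    ∃ e : IsoClasses G ≃ {d : ℕ // d ∣ Nat.card G},
      (∀ H : Subgroup G, (e (IsoCls H) : ℕ) = Nat.card H) ∧
      (∀ x y : IsoClasses G, x ≤ y ↔ (e x : ℕ) ∣ (e y : ℕ)) ∧
      (∀ H K : Subgroup G, Nonempty (H ≃* K) ↔ Nat.card H = Nat.card K) ∧
      (∀ H K : Subgroup G, IsoCls H ≤ IsoCls K ↔ Nat.card H ∣ Nat.card K) := by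
  have : IsZGroup G := ⟨fun p hp P ↦ have := Fact.mk hp; hZM p P⟩
  let f : IsoClasses G → {d : ℕ // d ∣ Nat.card G} :=
    Quotient.lift (fun H ↦ ⟨Nat.card H, H.card_subgroup_dvd_card⟩) fun _ _ h ↦
      Subtype.ext (IsZGroup.nonempty_mulEquiv_iff_card_eq.mp h)
  have hf : Function.Bijective f := by
    constructor
    · rintro ⟨H⟩ ⟨K⟩ h
      exact IsZGroup.isoCls_eq_iff.mpr (congrArg Subtype.val h)
    · rintro ⟨d, hd⟩
      obtain ⟨H, hH⟩ := IsZGroup.exists_subgroup_card_eq hd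
      exact ⟨IsoCls H, Subtype.ext hH⟩
  refine ⟨Equiv.ofBijective f hf, fun _ ↦ rfl, ?_,
    fun _ _ ↦ IsZGroup.nonempty_mulEquiv_iff_card_eq, fun _ _ ↦ IsZGroup.isoCls_le_iff⟩
  rintro ⟨H⟩ ⟨K⟩
  exact IsZGroup.isoCls_le_iff
end

section
/- Let G be a nontrivial finite group. Then Iso(G) is a chain (i.e., any two classes are comparable: for all subgroups H, K of G, either H admits an injective group homomorphism into K or K admits one into H) if and only if G is a cyclic p-group for some prime p, or an elementary abelian p-group for some prime p, or a non-abelian group of order p^3 and exponent p for some prime p, or isomorphic to the quaternion group Q₈ of order 8. -/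
section

open scoped Pointwise commutatorElement

/-- Any two subgroups of `G` are comparable by embeddability. -/
def SubgroupsComparable (G : Type*) [Group G] : Prop :=
  ∀ H K : Subgroup G,
    (∃ f : H →* K, Function.Injective f) ∨ (∃ f : K →* H, Function.Injective f)

/-- Any two subgroups of `G` of the same order are isomorphic. -/
def CardDeterminesSubgroups (G : Type*) [Group G] : Prop :=
  ∀ H K : Subgroup G, Nat.card H = Nat.card K → Nonempty (H ≃* K)

variable {G : Type*} [Group G] {p : ℕ}

lemma SubgroupsComparable.cardDeterminesSubgroups [Finite G] (h : SubgroupsComparable G) :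
    CardDeterminesSubgroups G := by
  intro H K hHK
  rcases h H K with ⟨f, hf⟩ | ⟨f, hf⟩
  · exact ⟨MulEquiv.ofBijective f ((Nat.bijective_iff_injective_and_card f).2 ⟨hf, hHK⟩)⟩
  · exact ⟨(MulEquiv.ofBijective f
      ((Nat.bijective_iff_injective_and_card f).2 ⟨hf, hHK.symm⟩)).symm⟩

lemma SubgroupsComparable.exists_isPGroup [Finite G] [Nontrivial G] (h : SubgroupsComparable G) :
    ∃ p : ℕ, p.Prime ∧ IsPGroup p G := by
  have hp : (Nat.card G).minFac.Prime := Nat.minFac_prime Finite.one_lt_card.ne'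
  refine ⟨_, hp, IsPGroup.of_card (Nat.eq_prime_pow_of_unique_prime_dvd Nat.card_pos.ne' ?_)⟩
  intro q hq hqG
  have := Fact.mk hp
  have := Fact.mk hq
  obtain ⟨x, hx⟩ := exists_prime_orderOf_dvd_card' _ (Nat.minFac_dvd (Nat.card G))
  obtain ⟨y, hy⟩ := exists_prime_orderOf_dvd_card' q hqG
  rcases h (Subgroup.zpowers x) (Subgroup.zpowers y) with ⟨f, hf⟩ | ⟨f, hf⟩
  · have := Subgroup.card_dvd_of_injective f hf
    rw [Nat.card_zpowers, Nat.card_zpowers, hx, hy] at this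
    exact ((Nat.prime_dvd_prime_iff_eq hp hq).1 this).symm
  · have := Subgroup.card_dvd_of_injective f hf
    rw [Nat.card_zpowers, Nat.card_zpowers, hx, hy] at this
    exact (Nat.prime_dvd_prime_iff_eq hq hp).1 this

lemma CardDeterminesSubgroups.subgroupsComparable [Finite G] (hp : p.Prime) (hG : IsPGroup p G)
    (h : CardDeterminesSubgroups G) : SubgroupsComparable G := by
  have embeds (H K : Subgroup G) (hHK : Nat.card H ≤ Nat.card K) :
      ∃ f : H →* K, Function.Injective f := by
    have := Fact.mk hp
    obtain ⟨n, hn⟩ := (hG.to_subgroup H).exists_card_eq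
    obtain ⟨L, hLK, hL⟩ := Sylow.exists_subgroup_le_card_pow_prime_of_le_card hp hG (hn ▸ hHK)
    obtain ⟨e⟩ := h H L (hn.trans hL.symm)
    exact ⟨(Subgroup.inclusion hLK).comp e.toMonoidHom,
      (Subgroup.inclusion_injective hLK).comp e.injective⟩
  intro H K
  exact (le_total (Nat.card H) (Nat.card K)).imp (embeds H K) (embeds K H)

lemma cardDeterminesSubgroups_of_isCyclic [IsCyclic G] : CardDeterminesSubgroups G :=
  fun _ _ hHK => ⟨mulEquivOfCyclicCardEq hHK⟩

lemma nonempty_linearEquiv_of_card_eq [Fact p.Prime] {V W : Type*} [AddCommGroup V]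
    [AddCommGroup W] [Module (ZMod p) V] [Module (ZMod p) W] [Finite V] [Finite W]
    (h : Nat.card V = Nat.card W) : Nonempty (V ≃ₗ[ZMod p] W) := by
  refine ⟨LinearEquiv.ofFinrankEq V W
    (Nat.pow_right_injective (Fact.out : p.Prime).two_le ?_)⟩
  change p ^ _ = p ^ _
  rw [FiniteField.pow_finrank_eq_natCard, FiniteField.pow_finrank_eq_natCard, h]

lemma nonempty_mulEquiv_of_pow_prime_eq_one (hp : p.Prime) {H K : Type*} [Group H] [Group K]
    [Finite H] [Finite K] (hH : ∀ a b : H, a * b = b * a) (hK : ∀ a b : K, a * b = b * a)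
    (hHp : ∀ a : H, a ^ p = 1) (hKp : ∀ a : K, a ^ p = 1) (hHK : Nat.card H = Nat.card K) :
    Nonempty (H ≃* K) := by
  have := Fact.mk hp
  let _ : CommGroup H := { mul_comm := hH }
  let _ : CommGroup K := { mul_comm := hK }
  let _ : Module (ZMod p) (Additive H) := AddCommGroup.zmodModule hHp
  let _ : Module (ZMod p) (Additive K) := AddCommGroup.zmodModule hKp
  exact (nonempty_linearEquiv_of_card_eq (p := p) (V := Additive H) (W := Additive K) hHK).map
    fun e => MulEquiv.toAdditive.symm e.toAddEquiv

lemma cardDeterminesSubgroups_of_elementary [Finite G] (hp : p.Prime)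
    (hc : ∀ a b : G, a * b = b * a) (he : ∀ g : G, g ^ p = 1) : CardDeterminesSubgroups G :=
  fun _ _ => nonempty_mulEquiv_of_pow_prime_eq_one hp
    (fun a b => Subtype.ext (hc a b)) (fun a b => Subtype.ext (hc a b))
    (fun a => Subtype.ext (he a)) (fun a => Subtype.ext (he a))

lemma mul_comm_of_card_eq_prime_pow_of_lt_three (hp : p.Prime) {n : ℕ} (hn : n < 3)
    (hG : Nat.card G = p ^ n) (a b : G) : a * b = b * a := by
  have := Fact.mk hp
  interval_cases n
  · have := (Nat.card_eq_one_iff_unique.1 (hG.trans (pow_zero p))).1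
    exact Subsingleton.elim _ _
  · have := isCyclic_of_prime_card (hG.trans (pow_one p))
    exact IsMulCommutative.is_comm.comm a b
  · have := IsPGroup.isMulCommutative_of_card_eq_prime_sq hG
    exact this.is_comm.comm a b

lemma cardDeterminesSubgroups_of_card_eq_prime_cube [Finite G] (hp : p.Prime)
    (hG : Nat.card G = p ^ 3) (he : ∀ g : G, g ^ p = 1) : CardDeterminesSubgroups G := by
  intro H K hHK
  obtain ⟨n, hn3, hn⟩ := (Nat.dvd_prime_pow hp).1 (hG ▸ H.card_subgroup_dvd_card)
  rcases hn3.lt_or_eq with hlt | rfl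
  · exact nonempty_mulEquiv_of_pow_prime_eq_one hp
      (mul_comm_of_card_eq_prime_pow_of_lt_three hp hlt hn)
      (mul_comm_of_card_eq_prime_pow_of_lt_three hp hlt (hHK ▸ hn))
      (fun a => Subtype.ext (he a)) (fun a => Subtype.ext (he a)) hHK
  · rw [H.eq_top_of_card_eq (hn.trans hG.symm),
      K.eq_top_of_card_eq (hHK.symm.trans (hn.trans hG.symm))]
    exact ⟨MulEquiv.refl _⟩

lemma cardDeterminesSubgroups_of_equiv_quaternion [Finite G] (e : G ≃* QuaternionGroup 2) :
    CardDeterminesSubgroups G := by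
  have hG : Nat.card G = 2 ^ 3 := by
    rw [Nat.card_congr e.toEquiv, Nat.card_eq_fintype_card]
    decide
  obtain ⟨z, hz⟩ : ∃ z : G, ∀ g : G, g ^ 2 = 1 → g = 1 ∨ g = z := by
    have key : ∀ q : QuaternionGroup 2, q ^ 2 = 1 → q = 1 ∨ q = .a 2 := by decide
    refine ⟨e.symm (.a 2), fun g hg => ?_⟩
    rcases key (e g) (by rw [← map_pow, hg, map_one]) with h | h
    · exact Or.inl (by simpa using h)
    · exact Or.inr (e.eq_symm_apply.2 h)
  have cyclic (H : Subgroup G) {n : ℕ} (hn : n < 3) (hH : Nat.card H = 2 ^ n) :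
      IsCyclic H := by
    have := Fact.mk Nat.prime_two
    interval_cases n
    · have := (Nat.card_eq_one_iff_unique.1 hH).1
      exact isCyclic_of_subsingleton
    · exact isCyclic_of_prime_card (hH.trans (pow_one 2))
    · obtain ⟨g, hg⟩ : ∃ g : H, g ^ 2 ≠ 1 := by
        by_contra! hall
        have hsub : (H : Set G) ⊆ {1, z} := fun g hg => by
          simpa using hz g (congrArg Subtype.val (hall ⟨g, hg⟩))
        have hle := Set.ncard_le_ncard hsub
        have htwo : ({1, z} : Set G).ncard ≤ 2 := Set.ncard_insert_le _ _ |>.trans (by simp)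
        have : (H : Set G).ncard = 2 ^ 2 := by rw [← hH]; rfl
        omega
      refine isCyclic_of_orderOf_eq_card g ?_
      rw [hH]
      refine orderOf_eq_prime_pow (p := 2) (n := 1) (by simpa using hg) ?_
      rw [← hH, pow_card_eq_one']
  intro H K hHK
  obtain ⟨n, hn3, hn⟩ := (Nat.dvd_prime_pow Nat.prime_two).1 (hG ▸ H.card_subgroup_dvd_card)
  rcases hn3.lt_or_eq with hlt | rfl
  · have := cyclic H hlt hn
    have := cyclic K hlt (hHK ▸ hn)
    exact ⟨mulEquivOfCyclicCardEq hHK⟩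
  · rw [H.eq_top_of_card_eq (hn.trans hG.symm),
      K.eq_top_of_card_eq (hHK.symm.trans (hn.trans hG.symm))]
    exact ⟨MulEquiv.refl _⟩

lemma IsPGroup.pow_succ_le_card_of_lt [Finite G] (hp : p.Prime) (hG : IsPGroup p G)
    {H K : Subgroup G} (hHK : H < K) {n : ℕ} (hn : p ^ n ≤ Nat.card H) :
    p ^ (n + 1) ≤ Nat.card K := by
  have := Fact.mk hp
  obtain ⟨m, hm⟩ := (hG.to_subgroup K).exists_card_eq
  have hlt : Nat.card H < Nat.card K := by
    refine lt_of_le_of_ne (Subgroup.card_le_of_le hHK.le) fun h => hHK.ne ?_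
    exact Subgroup.eq_of_le_of_card_ge hHK.le h.ge
  rw [hm] at hlt ⊢
  exact Nat.pow_le_pow_right hp.pos ((Nat.pow_lt_pow_iff_right hp.one_lt).1 (hn.trans_lt hlt))

lemma closure_mul_comm {s : Set G} (hs : ∀ a ∈ s, ∀ b ∈ s, a * b = b * a) :
    ∀ a ∈ Subgroup.closure s, ∀ b ∈ Subgroup.closure s, a * b = b * a := by
  intro a ha b hb
  exact congrArg Subtype.val
    ((Subgroup.isMulCommutative_closure hs).is_comm.comm ⟨a, ha⟩ ⟨b, hb⟩)

lemma card_closure_pair_le {x y w : G} (hp : 0 < p) (hx : x ^ p = 1) (hy : y ^ p = 1)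
    (hw : w ^ p = 1) (hyx : y * x = x * y * w) (hwx : Commute w x) (hwy : Commute w y) :
    Nat.card (Subgroup.closure {x, y}) ≤ p ^ 3 := by
  have zpowers_card_le {g : G} (hg : g ^ p = 1) : Nat.card (Subgroup.zpowers g) ≤ p := by
    rw [Nat.card_zpowers]
    exact Nat.le_of_dvd hp (orderOf_dvd_of_pow_eq_one hg)
  have conj : x⁻¹ * y * x = y * w := by rw [mul_assoc, hyx]; group
  have conj' : x * y * x⁻¹ = y * w⁻¹ := by
    rw [mul_inv_eq_iff_eq_mul, mul_assoc, hwx.inv_left.eq, ← mul_assoc, hyx]; group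
  have conj_zpow_inv (j : ℤ) : (x⁻¹ * y * x) ^ j = x⁻¹ * y ^ j * x := by
    simpa using conj_zpow (i := j) (a := x⁻¹) (b := y)
  have form : ∀ g ∈ Subgroup.closure {x, y}, ∃ i j k : ℤ, g = x ^ i * y ^ j * w ^ k := by
    intro g hg
    induction hg using Subgroup.closure_induction_right with
    | one => exact ⟨0, 0, 0, by simp⟩
    | mul_right g _ s hs ih =>
      obtain ⟨i, j, k, rfl⟩ := ih
      rcases hs with rfl | rfl
      · refine ⟨i + 1, j, j + k, ?_⟩
        have h : y ^ j * s = s * (y ^ j * w ^ j) := by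
          rw [← hwy.symm.mul_zpow, ← conj, conj_zpow_inv]; group
        rw [mul_assoc, (hwx.zpow_left k).eq, ← mul_assoc, mul_assoc (s ^ i), h, zpow_add,
          zpow_add]
        simp only [mul_assoc, zpow_one]
      · refine ⟨i, j + 1, k, ?_⟩
        rw [mul_assoc, (hwy.zpow_left k).eq, zpow_add]
        simp only [mul_assoc, zpow_one]
    | mul_inv_cancel g _ s hs ih =>
      obtain ⟨i, j, k, rfl⟩ := ih
      rcases hs with rfl | rfl
      · refine ⟨i - 1, j, -j + k, ?_⟩
        have h : y ^ j * s⁻¹ = s⁻¹ * (y ^ j * w ^ (-j)) := by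
          rw [zpow_neg, ← inv_zpow, ← hwy.symm.inv_right.mul_zpow, ← conj', conj_zpow]; group
        rw [mul_assoc, (hwx.inv_right.zpow_left k).eq, ← mul_assoc, mul_assoc (s ^ i), h,
          zpow_sub, zpow_add]
        simp only [mul_assoc, zpow_one]
      · refine ⟨i, j - 1, k, ?_⟩
        rw [mul_assoc, (hwy.inv_right.zpow_left k).eq, zpow_sub]
        simp only [mul_assoc, zpow_one]
  have finite_zpowers {g : G} (hg : g ^ p = 1) : (Subgroup.zpowers g : Set G).Finite :=
    isOfFinOrder_iff_pow_eq_one.2 ⟨p, hp, hg⟩ |>.finite_zpowers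
  set S : Set G := (Subgroup.zpowers x : Set G) * (Subgroup.zpowers y : Set G) *
    (Subgroup.zpowers w : Set G)
  have hSfin : S.Finite := ((finite_zpowers hx).mul (finite_zpowers hy)).mul (finite_zpowers hw)
  have hsub : (Subgroup.closure {x, y} : Set G) ⊆ S := by
    intro g hg
    obtain ⟨i, j, k, rfl⟩ := form g hg
    exact Set.mul_mem_mul (Set.mul_mem_mul ⟨i, rfl⟩ ⟨j, rfl⟩) ⟨k, rfl⟩
  calc Nat.card (Subgroup.closure {x, y}) ≤ Nat.card S := Nat.card_mono hSfin hsub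
    _ ≤ Nat.card (Subgroup.zpowers x) * Nat.card (Subgroup.zpowers y) *
        Nat.card (Subgroup.zpowers w) :=
      Set.natCard_mul_le.trans (Nat.mul_le_mul_right _ Set.natCard_mul_le)
    _ ≤ p * p * p := by
      gcongr
      exacts [zpowers_card_le hx, zpowers_card_le hy, zpowers_card_le hw]
    _ = p ^ 3 := by ring

/-- A noncommutative `p`-group has a noncentral element which is central modulo the center. -/
lemma IsPGroup.exists_notMem_center_commutator_mem_center [Finite G] [Fact p.Prime]
    (hG : IsPGroup p G) (hc : ¬ ∀ a b : G, a * b = b * a) :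
    ∃ x : G, x ∉ Subgroup.center G ∧ ∀ g : G, ⁅x, g⁆ ∈ Subgroup.center G := by
  have : Nontrivial (G ⧸ Subgroup.center G) := by
    rw [← not_subsingleton_iff_nontrivial, QuotientGroup.subsingleton_iff]
    intro h
    refine hc fun a b => ?_
    exact (Subgroup.mem_center_iff.1 (h ▸ Subgroup.mem_top b) a)
  have := (hG.to_quotient (Subgroup.center G)).center_nontrivial
  obtain ⟨⟨q, hq⟩, hq1⟩ := exists_ne (1 : Subgroup.center (G ⧸ Subgroup.center G))
  obtain ⟨x, rfl⟩ := QuotientGroup.mk_surjective q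
  refine ⟨x, fun hx => hq1 (Subtype.ext ((QuotientGroup.eq_one_iff x).2 hx)), fun g => ?_⟩
  rw [← QuotientGroup.eq_one_iff, commutatorElement_def]
  have := Subgroup.mem_center_iff.1 hq (g : G ⧸ Subgroup.center G)
  simp only [QuotientGroup.mk_mul, QuotientGroup.mk_inv]
  rw [← this]
  group

lemma card_le_card_centralizer_mul_card_center [Finite G] {x : G}
    (hx : ∀ g : G, ⁅x, g⁆ ∈ Subgroup.center G) :
    Nat.card G ≤ Nat.card (Subgroup.centralizer {x}) * Nat.card (Subgroup.center G) := by
  let f : G →* Subgroup.center G := MonoidHom.mk' (fun g => ⟨⁅x, g⁆, hx g⟩) fun g h => by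
    refine Subtype.ext ?_
    change ⁅x, g * h⁆ = ⁅x, g⁆ * ⁅x, h⁆
    have := Subgroup.mem_center_iff.1 (hx h) g⁻¹
    calc ⁅x, g * h⁆ = x * g * x⁻¹ * (⁅x, h⁆ * g⁻¹) := by
          simp only [commutatorElement_def]; group
      _ = ⁅x, g⁆ * ⁅x, h⁆ := by rw [← this]; simp only [commutatorElement_def]; group
  have hker : f.ker ≤ Subgroup.centralizer {x} := by
    intro g hg
    have hg : ⁅x, g⁆ = 1 := congrArg Subtype.val (MonoidHom.mem_ker.1 hg)
    rw [commutatorElement_eq_one_iff_mul_comm] at hg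
    exact Subgroup.mem_centralizer_singleton_iff.2 hg.symm
  rw [← f.ker.card_mul_index, Subgroup.index_ker]
  exact Nat.mul_le_mul (Subgroup.card_le_of_le hker) (Subgroup.card_le_card_group _)

lemma IsPGroup.exists_commutative_subgroup_card_eq_prime_cube [Finite G] (hp : p.Prime)
    (hG : IsPGroup p G) (hcard : p ^ 4 ≤ Nat.card G) {x : G} (hxZ : x ∉ Subgroup.center G)
    (hx : ∀ g : G, ⁅x, g⁆ ∈ Subgroup.center G) :
    ∃ A : Subgroup G, Nat.card A = p ^ 3 ∧ ∀ a ∈ A, ∀ b ∈ A, a * b = b * a := by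
  have := Fact.mk hp
  suffices h : ∃ A : Subgroup G, p ^ 3 ≤ Nat.card A ∧ ∀ a ∈ A, ∀ b ∈ A, a * b = b * a by
    obtain ⟨A, hA, hAc⟩ := h
    obtain ⟨B, hBA, hB⟩ := Sylow.exists_subgroup_le_card_pow_prime_of_le_card hp hG hA
    exact ⟨B, hB, fun a ha b hb => hAc a (hBA ha) b (hBA hb)⟩
  set Z := Subgroup.center G
  have comm_of_mem {a : G} (ha : a ∈ Z) (b : G) : a * b = b * a :=
    (Subgroup.mem_center_iff.1 ha b).symm
  set E := Subgroup.closure (insert x (Z : Set G))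
  have hZE : Z < E := by
    refine lt_of_le_of_ne (fun z hz => Subgroup.subset_closure (Or.inr hz)) fun h => hxZ ?_
    rw [h]
    exact Subgroup.subset_closure (Or.inl rfl)
  by_cases hE3 : p ^ 3 ≤ Nat.card E
  · refine ⟨E, hE3, closure_mul_comm ?_⟩
    rintro a (rfl | ha) b (rfl | hb)
    exacts [rfl, (comm_of_mem hb _).symm, comm_of_mem ha _, comm_of_mem ha _]
  have hZ1 : Nat.card Z = p := by
    obtain ⟨n, hn⟩ := (hG.to_subgroup Z).exists_card_eq
    have hn2 : n + 1 < 3 := by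
      by_contra! h
      exact hE3 ((Nat.pow_le_pow_right hp.pos h).trans
        (hG.pow_succ_le_card_of_lt hp hZE hn.ge))
    have : Nontrivial G := ⟨x, 1, fun h => hxZ (h ▸ Z.one_mem)⟩
    have : Nontrivial Z := hG.center_nontrivial
    have hn0 : n ≠ 0 := by
      rintro rfl
      exact Finite.one_lt_card.ne' (hn.trans (pow_zero p))
    rw [hn, show n = 1 by omega, pow_one]
  have hCx : p ^ 3 ≤ Nat.card (Subgroup.centralizer {x}) := by
    have := hcard.trans (card_le_card_centralizer_mul_card_center hx)
    rw [hZ1, pow_succ] at this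
    exact Nat.le_of_mul_le_mul_right this hp.pos
  obtain ⟨g, hgC, hgE⟩ : ∃ g ∈ Subgroup.centralizer {x}, g ∉ E :=
    Set.not_subset.1 fun h => hE3 (hCx.trans (Subgroup.card_le_of_le h))
  have hgx : g * x = x * g := Subgroup.mem_centralizer_singleton_iff.1 hgC
  refine ⟨Subgroup.closure (insert g (insert x (Z : Set G))), ?_, closure_mul_comm ?_⟩
  · refine hG.pow_succ_le_card_of_lt hp (H := E) ?_
      (hG.pow_succ_le_card_of_lt hp hZE (n := 1) (by rw [hZ1, pow_one]))
    refine lt_of_le_of_ne (Subgroup.closure_mono (Set.subset_insert _ _)) fun h => hgE ?_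
    rw [h]
    exact Subgroup.subset_closure (Or.inl rfl)
  · rintro a (rfl | rfl | ha) b (rfl | rfl | hb)
    exacts [rfl, hgx, (comm_of_mem hb _).symm, hgx.symm, rfl, (comm_of_mem hb _).symm,
      comm_of_mem ha _, comm_of_mem ha _, comm_of_mem ha _]

lemma CardDeterminesSubgroups.card_eq_prime_cube [Finite G] (h : CardDeterminesSubgroups G)
    (hp : p.Prime) (hG : IsPGroup p G) (he : ∀ g : G, g ^ p = 1)
    (hc : ¬ ∀ a b : G, a * b = b * a) : Nat.card G = p ^ 3 := by
  have := Fact.mk hp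
  obtain ⟨x, hxZ, hx⟩ := hG.exists_notMem_center_commutator_mem_center hc
  obtain ⟨y, hxy⟩ : ∃ y, y * x ≠ x * y := by
    simpa [Subgroup.mem_center_iff] using hxZ
  have hw (g : G) : Commute ⁅y⁻¹, x⁻¹⁆ g := by
    have : ⁅x⁻¹, y⁻¹⁆ ∈ Subgroup.center G := by
      have hN := (Subgroup.center G).inv_mem
        ((Subgroup.Normal.conj_mem inferInstance _ (hx y⁻¹) x⁻¹))
      convert hN using 1
      simp only [commutatorElement_def]; group
    rw [← commutatorElement_inv]
    exact (Subgroup.mem_center_iff.1 ((Subgroup.center G).inv_mem this) g).symm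
  set H := Subgroup.closure {x, y}
  have hHle : Nat.card H ≤ p ^ 3 :=
    card_closure_pair_le hp.pos (he x) (he y) (he _)
      (by simp only [commutatorElement_def]; group) (hw x) (hw y)
  have hHnc : ¬ ∀ a b : H, a * b = b * a := fun hH =>
    hxy (congrArg Subtype.val (hH ⟨y, Subgroup.subset_closure (Or.inr rfl)⟩
      ⟨x, Subgroup.subset_closure (Or.inl rfl)⟩))
  obtain ⟨n, hn⟩ := (hG.to_subgroup H).exists_card_eq
  have hn3 : 3 ≤ n := by
    by_contra! hlt
    exact hHnc (mul_comm_of_card_eq_prime_pow_of_lt_three hp hlt hn)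
  have hH : Nat.card H = p ^ 3 := le_antisymm hHle (hn ▸ Nat.pow_le_pow_right hp.pos hn3)
  obtain ⟨m, hm⟩ := hG.exists_card_eq
  have hm3 : 3 ≤ m := (Nat.pow_le_pow_iff_right hp.one_lt).1
    (hH ▸ hm ▸ Subgroup.card_le_card_group H)
  rcases hm3.eq_or_lt with rfl | hm4
  · exact hm
  · obtain ⟨A, hA, hAc⟩ := hG.exists_commutative_subgroup_card_eq_prime_cube hp
      (hm ▸ Nat.pow_le_pow_right hp.pos hm4) hxZ hx
    obtain ⟨e⟩ := h H A (hH.trans hA.symm)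
    refine absurd (fun a b => e.injective ?_) hHnc
    rw [map_mul, map_mul]
    exact Subtype.ext (hAc _ (e a).2 _ (e b).2)

lemma pow_eq_one_of_mem_zpowers {u g : G} {n : ℕ} (hu : u ^ n = 1)
    (hg : g ∈ Subgroup.zpowers u) : g ^ n = 1 := by
  obtain ⟨k, rfl⟩ := hg
  rw [← zpow_natCast, ← zpow_mul, mul_comm, zpow_mul, zpow_natCast, hu, one_zpow]

lemma mem_zpowers_of_mem_zpowers_of_prime (hp : p.Prime) {u g h : G} (hu : u ^ p = 1)
    (hg : g ∈ Subgroup.zpowers u) (hh : h ∈ Subgroup.zpowers u) (hg1 : g ≠ 1) :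
    h ∈ Subgroup.zpowers g := by
  have := Fact.mk hp
  have hgp := orderOf_eq_prime (pow_eq_one_of_mem_zpowers hu hg) hg1
  have hup : orderOf u = p := orderOf_eq_prime hu (by rintro rfl; simp_all)
  have : Finite (Subgroup.zpowers u) := Nat.finite_of_card_ne_zero (by
    rw [Nat.card_zpowers, hup]
    exact hp.ne_zero)
  rwa [Subgroup.eq_of_le_of_card_ge (Subgroup.zpowers_le.2 hg)
    (by rw [Nat.card_zpowers, Nat.card_zpowers, hgp, hup])]

/-- If all subgroups of each order are isomorphic and the exponent is not `p`, then there is a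
unique subgroup of order `p`. -/
lemma CardDeterminesSubgroups.mem_zpowers_of_pow_eq_one [Finite G]
    (h : CardDeterminesSubgroups G) (hp : p.Prime) (hG : IsPGroup p G) {a : G}
    (ha : a ^ p ≠ 1) {g k : G} (hg : g ^ p = 1) (hk : k ^ p = 1) (hg1 : g ≠ 1) :
    k ∈ Subgroup.zpowers g := by
  have := Fact.mk hp
  have : Nontrivial G := ⟨g, 1, hg1⟩
  have : Nontrivial (Subgroup.center G) := hG.center_nontrivial
  obtain ⟨⟨u, huZ⟩, hu⟩ := exists_prime_orderOf_dvd_card' p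
    ((hG.to_subgroup (Subgroup.center G)).card_eq_or_dvd.resolve_left Finite.one_lt_card.ne')
  rw [Subgroup.orderOf_mk] at hu
  have hup : u ^ p = 1 := hu ▸ pow_orderOf_eq_one u
  suffices mem : ∀ x : G, x ^ p = 1 → x ∈ Subgroup.zpowers u from
    mem_zpowers_of_mem_zpowers_of_prime hp hup (mem g hg) (mem k hk) hg1
  intro x hx
  by_contra hxu
  have hlt : Subgroup.zpowers u < Subgroup.closure {x, u} := by
    refine lt_of_le_of_ne (Subgroup.zpowers_le.2 (Subgroup.subset_closure (Or.inr rfl)))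
      fun heq => hxu ?_
    rw [heq]
    exact Subgroup.subset_closure (Or.inl rfl)
  obtain ⟨L, hLK, hL⟩ := Sylow.exists_subgroup_le_card_pow_prime_of_le_card hp hG
    (hG.pow_succ_le_card_of_lt hp hlt (n := 1) (by rw [Nat.card_zpowers, hu, pow_one]))
  have hap : p ^ 2 ≤ Nat.card (Subgroup.zpowers a) := by
    obtain ⟨n, hn⟩ := IsPGroup.iff_orderOf.1 hG a
    rw [Nat.card_zpowers, hn]
    refine Nat.pow_le_pow_right hp.pos ?_
    by_contra! hlt
    exact ha (orderOf_dvd_iff_pow_eq_one.1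
      (hn ▸ (pow_dvd_pow p (Nat.le_of_lt_succ hlt)).trans (pow_one p).dvd))
  obtain ⟨C, hCa, hC⟩ := Sylow.exists_subgroup_le_card_pow_prime_of_le_card hp hG hap
  have : IsCyclic C := isCyclic_of_injective _ (Subgroup.inclusion_injective hCa)
  obtain ⟨c, hc⟩ := IsCyclic.exists_ofOrder_eq_natCard (α := C)
  obtain ⟨e⟩ := h C L (hC.trans hL.symm)
  have hxu' : ∀ y ∈ Subgroup.closure {x, u}, y ^ p = 1 := by
    have hcomm := closure_mul_comm (s := {x, u}) (by
      have := Subgroup.mem_center_iff.1 huZ x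
      rintro _ (rfl | rfl) _ (rfl | rfl)
      exacts [rfl, this, this.symm, rfl])
    intro y hy
    induction hy using Subgroup.closure_induction with
    | mem y hy => rcases hy with rfl | rfl <;> assumption
    | one => exact one_pow p
    | mul y z hy hz ihy ihz =>
      rw [(show Commute y z from hcomm y hy z hz).mul_pow, ihy, ihz, one_mul]
    | inv y _ ih => rw [inv_pow, ih, inv_one]
  have hcp : c ^ p = 1 := e.injective (by
    rw [map_pow, map_one]
    exact Subtype.ext (hxu' _ (hLK (e c).2)))
  have hdvd := orderOf_dvd_of_pow_eq_one hcp
  rw [hc, hC] at hdvd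
  have := (Nat.pow_dvd_pow_iff_le_right hp.one_lt).1 (hdvd.trans (pow_one p).symm.dvd)
  omega

lemma mul_pow_of_commute_commutator {b y v : G} (hyb : y * b = b * y * v) (hvb : Commute v b)
    (hvy : Commute v y) (n : ℕ) : (b * y) ^ n = b ^ n * y ^ n * v ^ n.choose 2 := by
  have conj : b⁻¹ * y * b = y * v := by rw [mul_assoc, hyb]; group
  induction n with
  | zero => simp
  | succ n ih =>
    have h : y ^ n * b = b * (y ^ n * v ^ n) := by
      have hpow : (b⁻¹ * y * b) ^ n = b⁻¹ * y ^ n * b := by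
        simpa using conj_pow (i := n) (a := b⁻¹) (b := y)
      rw [← hvy.symm.mul_pow, ← conj, hpow]; group
    calc (b * y) ^ (n + 1) = b ^ n * y ^ n * (v ^ n.choose 2 * (b * y)) := by
          rw [pow_succ, ih, mul_assoc]
      _ = b ^ n * (y ^ n * b) * y * v ^ n.choose 2 := by
          rw [((hvb.mul_right hvy).pow_left _).eq]; simp only [mul_assoc]
      _ = b ^ (n + 1) * y ^ n * (v ^ n * y) * v ^ n.choose 2 := by
          rw [h, pow_succ]; simp only [mul_assoc]
      _ = b ^ (n + 1) * y ^ (n + 1) * v ^ (n + 1).choose 2 := by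
          rw [(hvy.pow_left n).eq, Nat.choose_succ_succ' n 1, Nat.choose_one_right, pow_add v,
            pow_succ y]
          simp only [mul_assoc]

lemma normal_of_card_eq_prime_pow [Finite G] (hp : p.Prime) {n : ℕ}
    (hG : Nat.card G = p ^ (n + 1)) {H : Subgroup G} (hH : Nat.card H = p ^ n) :
    H.index = p ∧ H.Normal := by
  have hindex : H.index = p := by
    have := H.card_mul_index
    rw [hG, hH, pow_succ] at this
    exact Nat.eq_of_mul_eq_mul_left (pow_pos hp.pos n) this
  refine ⟨hindex, Subgroup.normal_of_index_eq_minFac_card ?_⟩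
  rw [hindex, hG, hp.pow_minFac n.succ_ne_zero]

/-- A `p`-group with a unique subgroup of order `p`, generated by two distinct cyclic maximal
subgroups, is a noncommutative group of order `8`. -/
lemma eq_two_of_two_cyclic_maximal_subgroups [Finite G] (hp : p.Prime) {e : ℕ} (he : 2 ≤ e)
    (hG : Nat.card G = p ^ (e + 1)) {a b : G} (ha : orderOf a = p ^ e)
    (hb : b ∉ Subgroup.zpowers a) {B : Subgroup G} (hbB : b ∈ B) (hB : Nat.card B = p ^ e)
    [IsCyclic B]
    (hunique : ∀ g k : G, g ^ p = 1 → k ^ p = 1 → g ≠ 1 → k ∈ Subgroup.zpowers g) :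
    p = 2 ∧ e = 2 ∧ ∃ x y : G, x * y ≠ y * x := by
  have := Fact.mk hp
  set A := Subgroup.zpowers a
  have haA : a ∈ A := Subgroup.mem_zpowers a
  obtain ⟨hAi, hAn⟩ : A.index = p ∧ A.Normal :=
    normal_of_card_eq_prime_pow hp hG ((Nat.card_zpowers a).trans ha)
  obtain ⟨hBi, hBn⟩ := normal_of_card_eq_prime_pow hp hG hB
  have commA {x y : G} (hx : x ∈ A) (hy : y ∈ A) : Commute x y :=
    congrArg Subtype.val (IsMulCommutative.is_comm.comm (⟨x, hx⟩ : A) ⟨y, hy⟩)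
  have commB {x y : G} (hx : x ∈ B) (hy : y ∈ B) : Commute x y :=
    congrArg Subtype.val (IsMulCommutative.is_comm.comm (⟨x, hx⟩ : B) ⟨y, hy⟩)
  have mem_A {g : G} (hg : g ^ p = 1) : g ∈ A := by
    have h1 : a ^ p ^ (e - 1) ≠ 1 := by
      intro h
      have := orderOf_dvd_of_pow_eq_one h
      rw [ha, Nat.pow_dvd_pow_iff_le_right hp.one_lt] at this
      omega
    refine (Subgroup.zpowers_le.2 (A.pow_mem haA (p ^ (e - 1)))) (hunique _ g ?_ hg h1)
    rw [← pow_mul, ← pow_succ, Nat.sub_add_cancel (by omega), ← ha, pow_orderOf_eq_one]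
  obtain ⟨s, hs⟩ : b ^ p ∈ A := by simpa only [hAi] using A.pow_index_mem b
  simp only at hs
  obtain ⟨t, rfl⟩ : (p : ℤ) ∣ s := by
    by_contra hps
    have hcop : IsCoprime s (orderOf a : ℤ) := by
      rw [ha, Nat.cast_pow]
      exact ((Nat.prime_iff_prime_int.1 hp).coprime_iff_not_dvd.2 hps).symm.pow_right
    have hab : a ∈ Subgroup.zpowers b := by
      obtain ⟨m, n, hmn⟩ := hcop
      have : a = (b ^ p) ^ m := by
        rw [← hs, ← zpow_mul]
        conv_lhs => rw [← zpow_one a, ← hmn, zpow_add, mul_comm n, zpow_mul a (orderOf a : ℤ),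
          zpow_natCast, pow_orderOf_eq_one, one_zpow, mul_one, mul_comm]
      rw [this]
      exact Subgroup.zpow_mem _ (Subgroup.pow_mem _ (Subgroup.mem_zpowers b) p) m
    have hle : Nat.card (Subgroup.zpowers b) ≤ Nat.card A := by
      rw [Nat.card_zpowers a, ha, ← hB]
      exact Subgroup.card_le_of_le (Subgroup.zpowers_le.2 hbB)
    have heq : A = Subgroup.zpowers b :=
      Subgroup.eq_of_le_of_card_ge (Subgroup.zpowers_le.2 hab) hle
    exact hb (heq ▸ Subgroup.mem_zpowers b)
  set y := a ^ (-t) with hy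
  have hyA : y ∈ A := A.zpow_mem haA _
  set v := y⁻¹ * (b⁻¹ * y * b) with hv
  have hvA : v ∈ A := A.mul_mem (A.inv_mem hyA) (by simpa using hAn.conj_mem y hyA b⁻¹)
  have hvB : v ∈ B := by
    have := B.mul_mem (hBn.conj_mem b⁻¹ (B.inv_mem hbB) y⁻¹) hbB
    rwa [inv_inv, show y⁻¹ * b⁻¹ * y * b = v by rw [hv]; group] at this
  have hvy := commA hvA hyA
  have hvb := commB hvB hbB
  have hyv : b⁻¹ * y * b = y * v := by rw [hv]; group
  have pow_mem_B (g : G) : g ^ p ∈ B := by simpa only [hBi] using B.pow_index_mem g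
  have hvp : v ^ p = 1 := by
    have hpow : (b⁻¹ * y * b) ^ p = b⁻¹ * y ^ p * b := by
      simpa using conj_pow (i := p) (a := b⁻¹) (b := y)
    rw [hyv, hvy.symm.mul_pow, mul_assoc, (commB (pow_mem_B y) hbB).eq,
      inv_mul_cancel_left] at hpow
    exact mul_eq_left.1 hpow
  set c := b * y with hc
  have hcA : c ∉ A := fun h => hb ((A.mul_mem_cancel_right hyA).1 h)
  have hcp : c ^ p = v ^ p.choose 2 := by
    rw [hc, mul_pow_of_commute_commutator (by rw [hv]; group) hvb hvy, ← hs, hy,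
      ← zpow_natCast (a ^ (-t)), ← zpow_mul, ← zpow_add,
      show (p : ℤ) * t + -t * p = 0 by ring, zpow_zero, one_mul]
  have hp2 : p = 2 := by
    by_contra hne
    obtain ⟨k, hk⟩ := hp.dvd_choose_self two_ne_zero (hp.two_le.lt_of_ne' hne)
    exact hcA (mem_A (by rw [hcp, hk, pow_mul, hvp, one_pow]))
  subst hp2
  rw [Nat.choose_self, pow_one] at hcp
  set d := a ^ 2 ^ (e - 2) with hd
  have hdA : d ∈ A := A.pow_mem haA _
  have hd2 : d ^ 2 ≠ 1 := by
    rw [hd, ← pow_mul, ← pow_succ]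
    intro h
    have := orderOf_dvd_of_pow_eq_one h
    rw [ha, Nat.pow_dvd_pow_iff_le_right one_lt_two] at this
    omega
  have hd4 : (d ^ 2) ^ 2 = 1 := by
    have h2e : 2 ^ (e - 2) * 2 * 2 = 2 ^ e := by
      rw [← pow_succ, ← pow_succ, show e - 2 + 1 + 1 = e by omega]
    rw [hd, ← pow_mul, ← pow_mul, ← mul_assoc, h2e, ← ha, pow_orderOf_eq_one]
  have hcd : c ^ 2 = d ^ 2 := by
    have hc2 : c ^ 2 ≠ 1 := fun h => hcA (mem_A h)
    obtain ⟨k, hk⟩ := hunique (d ^ 2) (c ^ 2) hd4 (by rw [hcp, hvp]) hd2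
    simp only at hk
    rcases Int.even_or_odd' k with ⟨m, rfl | rfl⟩
    · rw [zpow_mul, zpow_ofNat, hd4, one_zpow] at hk
      exact absurd hk.symm hc2
    · rw [zpow_add, zpow_mul, zpow_ofNat, hd4, one_zpow, one_mul, zpow_one] at hk
      exact hk.symm
  have hncomm : ¬ Commute d c := fun h => by
    have h1 : (d * c⁻¹) ^ 2 = 1 := by
      rw [h.inv_right.mul_pow, inv_pow, hcd, mul_inv_cancel]
    exact hcA (A.inv_mem_iff.1 ((A.mul_mem_cancel_left hdA).1 (mem_A h1)))
  refine ⟨rfl, ?_, d, c, hncomm⟩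
  by_contra hne
  refine hncomm ?_
  rw [hd, show e - 2 = 1 + (e - 3) by omega, pow_add, pow_one, pow_mul]
  exact (((commB (pow_mem_B a) hbB).mul_right
    (commA (A.pow_mem haA 2) hyA)).pow_left _)

lemma CardDeterminesSubgroups.eq_two_of_not_isCyclic [Finite G] (h : CardDeterminesSubgroups G)
    (hp : p.Prime) (hG : IsPGroup p G) (hcyc : ¬ IsCyclic G) {a : G} (ha : a ^ p ≠ 1) :
    p = 2 ∧ (∀ g : G, g ^ 4 = 1) ∧ ∃ x y : G, x * y ≠ y * x := by
  have := Fact.mk hp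
  obtain ⟨m, hm⟩ := Finite.exists_max (orderOf : G → ℕ)
  obtain ⟨e, he⟩ := IsPGroup.iff_orderOf.1 hG m
  have order_le (g : G) : ∃ k ≤ e, orderOf g = p ^ k := by
    obtain ⟨k, hk⟩ := IsPGroup.iff_orderOf.1 hG g
    exact ⟨k, (Nat.pow_le_pow_iff_right hp.one_lt).1 (hk ▸ he ▸ hm g), hk⟩
  have he2 : 2 ≤ e := by
    by_contra! hlt
    obtain ⟨k, hke, hk⟩ := order_le a
    exact ha (orderOf_dvd_iff_pow_eq_one.1
      (hk ▸ (pow_dvd_pow p (hke.trans (Nat.le_of_lt_succ hlt))).trans (pow_one p).dvd))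
  obtain ⟨n, hn⟩ := hG.exists_card_eq
  have hen : e + 1 ≤ n := by
    have hle : e ≤ n := by
      rw [← Nat.pow_dvd_pow_iff_le_right hp.one_lt, ← he, ← hn]
      exact orderOf_dvd_natCard m
    refine hle.lt_of_ne fun heq => hcyc (isCyclic_of_orderOf_eq_card m ?_)
    rw [he, hn, heq]
  obtain ⟨M, hM, hmM⟩ := Sylow.exists_subgroup_card_pow_succ (hn ▸ pow_dvd_pow p hen)
    ((Nat.card_zpowers m).trans he)
  rw [Subgroup.zpowers_le] at hmM
  obtain ⟨b, hb⟩ : ∃ b : M, b ∉ Subgroup.zpowers (⟨m, hmM⟩ : M) := by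
    by_contra! hall
    have := orderOf_eq_card_of_forall_mem_zpowers hall
    rw [Subgroup.orderOf_mk, he, hM] at this
    exact absurd (Nat.pow_right_injective hp.two_le this) (by omega)
  obtain ⟨k, hke, hk⟩ := order_le b
  obtain ⟨B, hB, hbB⟩ := Sylow.exists_subgroup_card_pow_prime_le p
    (hM ▸ pow_dvd_pow p e.le_succ) (Subgroup.zpowers b)
    ((Nat.card_zpowers b).trans ((Subgroup.orderOf_coe b).symm.trans hk)) hke
  let φ := B.equivMapOfInjective M.subtype M.subtype_injective
  obtain ⟨ψ⟩ := h (B.map M.subtype) (Subgroup.zpowers m)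
    ((Nat.card_congr φ.symm.toEquiv).trans (by rw [hB, Nat.card_zpowers, he]))
  have : IsCyclic B := (φ.trans ψ).isCyclic.2 inferInstance
  obtain ⟨rfl, rfl, x, y, hxy⟩ := eq_two_of_two_cyclic_maximal_subgroups hp he2 hM
    ((Subgroup.orderOf_mk m hmM).trans he) hb (hbB (Subgroup.mem_zpowers b)) hB
    fun g k hg hk hg1 => by
      obtain ⟨i, hi⟩ := h.mem_zpowers_of_pow_eq_one hp hG ha (congrArg Subtype.val hg)
        (congrArg Subtype.val hk) (fun h1 => hg1 (Subtype.ext h1))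
      exact ⟨i, Subtype.ext hi⟩
  refine ⟨rfl, fun g => ?_, x, y, fun hc => hxy (Subtype.ext hc)⟩
  obtain ⟨k, hk2, hk⟩ := order_le g
  exact orderOf_dvd_iff_pow_eq_one.1 (hk ▸ pow_dvd_pow 2 hk2)

lemma nonempty_mulEquiv_quaternion [Finite G] (hexp : ∀ g : G, g ^ 4 = 1)
    (hunique : ∀ g k : G, g ^ 2 = 1 → k ^ 2 = 1 → g ≠ 1 → k ≠ 1 → g = k)
    (hnc : ∃ x y : G, x * y ≠ y * x) : Nonempty (G ≃* QuaternionGroup 2) := by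
  obtain ⟨i, j, hij⟩ := hnc
  have sq_ne_one {x y : G} (hxy : x * y ≠ y * x) : x ^ 2 ≠ 1 := by
    intro hx
    have hx1 : x ≠ 1 := by rintro rfl; simp at hxy
    have := hunique x (y * x * y⁻¹) hx (by rw [conj_pow, hx]; group) hx1 (by simpa using hx1)
    exact hxy (by rw [eq_mul_inv_iff_mul_eq] at this; exact this)
  have hi2 := sq_ne_one hij
  have hi4 := hexp i
  have eq_sq {g : G} (hg : g ^ 2 = 1) (hg1 : g ≠ 1) : g = i ^ 2 :=
    hunique g _ hg (by rw [← pow_mul, hi4]) hg1 hi2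
  have sq_eq (g : G) : g ^ 2 = 1 ∨ g ^ 2 = i ^ 2 :=
    or_iff_not_imp_left.2 (eq_sq (by rw [← pow_mul, hexp]))
  have hj2 : j ^ 2 = i ^ 2 := (sq_eq j).resolve_left (sq_ne_one hij.symm)
  have mem_of_commute {g : G} (hg : Commute g i) : g ∈ Subgroup.zpowers i := by
    have mem_of_sq {x : G} (hx : x ^ 2 = 1) : x ∈ Subgroup.zpowers i := by
      by_cases hx1 : x = 1
      · exact hx1 ▸ one_mem _
      · exact eq_sq hx hx1 ▸ Subgroup.pow_mem _ (Subgroup.mem_zpowers i) 2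
    rcases sq_eq g with h | h
    · exact mem_of_sq h
    · refine (Subgroup.mul_mem_cancel_right _
        (inv_mem (Subgroup.mem_zpowers i))).1 (mem_of_sq (x := g * i⁻¹) ?_)
      rw [hg.inv_right.mul_pow, inv_pow, h, mul_inv_cancel]
  have conj_eq {g : G} (hg : ¬ Commute g i) : g * i * g⁻¹ = i⁻¹ := by
    have hcomm : g * i * g⁻¹ * i⁻¹ = g ^ 2 * (g⁻¹ * i) ^ 2 * (i ^ 2)⁻¹ := by
      simp only [pow_two]; group
    have hne : g * i * g⁻¹ * i⁻¹ ≠ 1 := fun h =>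
      hg (mul_inv_eq_iff_eq_mul.1 (mul_inv_eq_one.1 h))
    have hinv : (i ^ 2)⁻¹ = i ^ 2 := inv_eq_of_mul_eq_one_left (by rw [← pow_add, hi4])
    have hii : i ^ 2 * i ^ 2 = 1 := by rw [← pow_add, hi4]
    have : g * i * g⁻¹ * i⁻¹ = i ^ 2 := by
      rw [hinv] at hcomm
      rcases sq_eq g with h1 | h1 <;> rcases sq_eq (g⁻¹ * i) with h2 | h2 <;>
        rw [h1, h2] at hcomm
      · rwa [one_mul, one_mul] at hcomm
      · exact absurd (by rwa [one_mul, hii] at hcomm) hne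
      · exact absurd (by rwa [mul_one, hii] at hcomm) hne
      · rwa [hii, one_mul] at hcomm
    rw [mul_inv_eq_iff_eq_mul] at this
    rw [this, eq_inv_iff_mul_eq_one, mul_assoc, ← pow_two, hii]
  have hji : j * i * j⁻¹ = i⁻¹ := conj_eq fun h => hij h.symm
  have hi_order : orderOf i = 4 :=
    orderOf_eq_prime_pow (p := 2) (n := 1) (by simpa using hi2) hi4
  let f : QuaternionGroup 2 → G
    | .a k => i ^ k.val
    | .xa k => j * i ^ k.val
  have pow_add_val (k l : ZMod (2 * 2)) : i ^ (k + l).val = i ^ k.val * i ^ l.val := by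
    rw [ZMod.val_add, ← pow_add, ← pow_mod_orderOf i (k.val + l.val), hi_order]
  have pow_sub_val (k l : ZMod (2 * 2)) : i ^ (k - l).val = (i ^ l.val)⁻¹ * i ^ k.val := by
    rw [eq_inv_mul_iff_mul_eq, ← pow_add_val, add_sub_cancel]
  have pow_mul_j (n : ℕ) : i ^ n * j = j * (i ^ n)⁻¹ := by
    have : j * (i ^ n)⁻¹ * j⁻¹ = i ^ n := by
      rw [← conj_inv, ← conj_pow, hji, inv_pow, inv_inv]
    exact (mul_inv_eq_iff_eq_mul.1 this).symm
  have map_mul (q r : QuaternionGroup 2) : f (q * r) = f q * f r := by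
    rcases q with k | k <;> rcases r with l | l
    · exact pow_add_val k l
    · change j * i ^ (l - k).val = i ^ k.val * (j * i ^ l.val)
      rw [← mul_assoc, pow_mul_j, pow_sub_val, mul_assoc]
    · change j * i ^ (k + l).val = j * i ^ k.val * i ^ l.val
      rw [pow_add_val, mul_assoc]
    · change i ^ ((2 : ℕ) + l - k : ZMod (2 * 2)).val = j * i ^ k.val * (j * i ^ l.val)
      have h2 : ((2 : ℕ) : ZMod (2 * 2)).val = 2 := rfl
      rw [pow_sub_val, pow_add_val, h2, mul_assoc j, ← mul_assoc _ j, pow_mul_j, ← mul_assoc,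
        ← mul_assoc, ← mul_assoc, ← pow_two j, hj2,
        ((Commute.refl i).pow_pow 2 k.val).inv_right.eq]
  let F : QuaternionGroup 2 →* G := MonoidHom.mk' f map_mul
  refine ⟨(MulEquiv.ofBijective F ⟨?_, fun g => ?_⟩).symm⟩
  · rw [injective_iff_map_eq_one]
    rintro (k | k) hk
    · have hk : i ^ k.val = 1 := hk
      have hdvd := orderOf_dvd_of_pow_eq_one hk
      rw [hi_order] at hdvd
      have := Nat.eq_zero_of_dvd_of_lt hdvd k.val_lt
      rw [(ZMod.val_eq_zero k).1 this, QuaternionGroup.a_zero]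
    · have hk : j * i ^ k.val = 1 := hk
      have := eq_inv_of_mul_eq_one_left hk
      exact absurd (this ▸ ((Commute.refl i).pow_right _).inv_right.eq) hij
  · have exists_val {x : G} (hx : x ∈ Subgroup.zpowers i) :
        ∃ k : ZMod (2 * 2), i ^ k.val = x := by
      classical
      obtain ⟨n, hn, rfl⟩ := Finset.mem_image.1 (mem_zpowers_iff_mem_range_orderOf.1 hx)
      rw [Finset.mem_range, hi_order] at hn
      exact ⟨(n : ZMod (2 * 2)), by rw [ZMod.val_natCast, Nat.mod_eq_of_lt hn]⟩
    by_cases hg : Commute g i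
    · obtain ⟨k, hk⟩ := exists_val (mem_of_commute hg)
      exact ⟨.a k, hk⟩
    · have : Commute (j⁻¹ * g) i := by
        have h : g * i = i⁻¹ * g := mul_inv_eq_iff_eq_mul.1 (conj_eq hg)
        have hj : j * i = i⁻¹ * j := mul_inv_eq_iff_eq_mul.1 hji
        change j⁻¹ * g * i = i * (j⁻¹ * g)
        rw [mul_assoc, h, inv_mul_eq_iff_eq_mul, ← mul_assoc, ← mul_assoc, hj]
        group
      obtain ⟨k, hk⟩ := exists_val (mem_of_commute this)
      exact ⟨.xa k, by change j * i ^ k.val = g; rw [hk, mul_inv_cancel_left]⟩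

end

/-- For a nontrivial finite group `G`, the poset `IsoClasses G` is a chain
(any two subgroups are comparable by embeddability) iff `G` is a cyclic `p`-group, an
elementary abelian `p`-group, a non-abelian group of order `p ^ 3` and exponent `p`, or
the quaternion group `Q₈` of order `8`. -/
theorem isoClasses_isChain_iff (G : Type*) [Group G] [Finite G] [Nontrivial G] :
    (∀ H K : Subgroup G,
        (∃ f : H →* K, Function.Injective f) ∨ (∃ f : K →* H, Function.Injective f)) ↔
      ((∃ p : ℕ, p.Prime ∧ IsPGroup p G ∧ IsCyclic G) ∨
       (∃ p : ℕ, p.Prime ∧ (∀ a b : G, a * b = b * a) ∧ ∀ g : G, g ^ p = 1) ∨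
       (∃ p : ℕ, p.Prime ∧ Nat.card G = p ^ 3 ∧ (¬ ∀ a b : G, a * b = b * a) ∧
          Monoid.exponent G = p) ∨
       Nonempty (G ≃* QuaternionGroup 2)) := by
  constructor
  · intro (hcomp : SubgroupsComparable G)
    obtain ⟨p, hp, hG⟩ := hcomp.exists_isPGroup
    have h := hcomp.cardDeterminesSubgroups
    by_cases he : ∀ g : G, g ^ p = 1
    · by_cases hc : ∀ a b : G, a * b = b * a
      · exact Or.inr (Or.inl ⟨p, hp, hc, he⟩)
      · refine Or.inr (Or.inr (Or.inl ⟨p, hp, h.card_eq_prime_cube hp hG he hc, hc, ?_⟩))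
        refine (hp.eq_one_or_self_of_dvd _
          (Monoid.exponent_dvd_of_forall_pow_eq_one he)).resolve_left fun h1 => ?_
        exact not_subsingleton G (Monoid.exp_eq_one_iff.1 h1)
    · push Not at he
      obtain ⟨a, ha⟩ := he
      by_cases hcyc : IsCyclic G
      · exact Or.inl ⟨p, hp, hG, hcyc⟩
      obtain ⟨rfl, hexp, hnc⟩ := h.eq_two_of_not_isCyclic hp hG hcyc ha
      refine Or.inr (Or.inr (Or.inr (nonempty_mulEquiv_quaternion hexp ?_ hnc)))
      intro g k hg hk hg1 hk1
      obtain ⟨n, rfl⟩ := h.mem_zpowers_of_pow_eq_one hp hG ha hg hk hg1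
      rcases Int.even_or_odd' n with ⟨m, rfl | rfl⟩
      · exact absurd (by simp only [zpow_mul, zpow_ofNat, hg, one_zpow]) hk1
      · simp only [zpow_add, zpow_mul, zpow_ofNat, hg, one_zpow, one_mul, pow_one]
  · rintro (⟨p, hp, hG, hcyc⟩ | ⟨p, hp, hc, he⟩ | ⟨p, hp, hG, -, he⟩ | ⟨⟨e⟩⟩)
    · exact cardDeterminesSubgroups_of_isCyclic.subgroupsComparable hp hG
    · exact (cardDeterminesSubgroups_of_elementary hp hc he).subgroupsComparable hp
        fun g => ⟨1, by rw [pow_one, he]⟩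
    · exact (cardDeterminesSubgroups_of_card_eq_prime_cube hp hG
        fun g => he ▸ Monoid.pow_exponent_eq_one g).subgroupsComparable hp (IsPGroup.of_card hG)
    · refine (cardDeterminesSubgroups_of_equiv_quaternion e).subgroupsComparable Nat.prime_two
        (IsPGroup.of_card (n := 3) ?_)
      rw [Nat.card_congr e.toEquiv, Nat.card_eq_fintype_card, QuaternionGroup.card]
      rfl
end

section
/- Let G₁ and G₂ be finite groups such that there is an order isomorphism between the posets Iso(G₁) and Iso(G₂). If G₁ is solvable, then G₂ is solvable. -/
/-- Two subgroups of coprime index in a finite group factorize the group. -/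
theorem Subgroup.exists_mul_eq_of_coprime_index {G : Type*} [Group G] [Finite G]
    {T A : Subgroup G} (h : Nat.Coprime T.index A.index) (g : G) :
    ∃ t ∈ T, ∃ a ∈ A, t * a = g := by
  have h1 : A.relIndex T * T.index = (A ⊓ T).index := by
    rw [← Subgroup.inf_relIndex_right, Subgroup.relIndex_mul_index inf_le_right]
  have h2 : A.index ∣ A.relIndex T :=
    h.symm.dvd_of_dvd_mul_right (h1 ▸ Subgroup.index_dvd_of_le inf_le_left)
  have h3 : MulAction.stabilizer T ((1 : G) : G ⧸ A) = A.subgroupOf T := by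
    ext t
    rw [MulAction.mem_stabilizer_iff, Subgroup.mem_subgroupOf, eq_comm]
    change ((1 : G) : G ⧸ A) = (((t : G) * 1 : G) : G ⧸ A) ↔ _
    rw [QuotientGroup.eq]
    simp
  have h4 : MulAction.orbit T ((1 : G) : G ⧸ A) = Set.univ := by
    apply Set.eq_of_subset_of_ncard_le (Set.subset_univ _)
    rw [← MulAction.index_stabilizer, h3, Set.ncard_univ, ← Subgroup.index_eq_card]
    exact Nat.le_of_dvd (Nat.pos_of_ne_zero Subgroup.index_ne_zero_of_finite) h2
  have h5 : (g : G ⧸ A) ∈ MulAction.orbit T ((1 : G) : G ⧸ A) := h4 ▸ Set.mem_univ _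
  obtain ⟨t, ht⟩ := h5
  refine ⟨t, t.2, (t : G)⁻¹ * g, ?_, by simp⟩
  rw [← QuotientGroup.eq, ← ht]
  change _ = (((t : G) * 1 : G) : G ⧸ A)
  rw [mul_one]

theorem Subgroup.le_normalCore_of_coprime_index {G : Type*} [Group G] [Finite G]
    {T A N : Subgroup G} (h : Nat.Coprime T.index A.index) (hN : A ≤ Subgroup.normalizer N)
    (hT : N ≤ T) : N ≤ T.normalCore := by
  intro x hx g
  obtain ⟨t, ht, a, ha, rfl⟩ := Subgroup.exists_mul_eq_of_coprime_index h g
  have : a * x * a⁻¹ ∈ T := hT ((Subgroup.mem_normalizer_iff.1 (hN ha) x).1 hx)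
  simpa [mul_assoc] using T.mul_mem (T.mul_mem ht this) (T.inv_mem ht)

theorem Group.exists_normal_isPGroup {G : Type*} [Group G] [Finite G] [Nontrivial G]
    (hG : Group.IsSolvable G) :
    ∃ (q : ℕ) (N : Subgroup G), q.Prime ∧ N.Normal ∧ N ≠ ⊥ ∧ IsPGroup q N := by
  classical
  have hex := hG.solvable
  obtain ⟨n, hn⟩ : ∃ n, Nat.find hex = n + 1 := by
    refine Nat.exists_eq_succ_of_ne_zero fun h => ?_
    have := Nat.find_spec hex
    rw [h, derivedSeries_zero] at this
    exact top_ne_bot this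
  have hA : derivedSeries G n ≠ ⊥ := Nat.find_min hex (by omega)
  have hA' : ⁅derivedSeries G n, derivedSeries G n⁆ = ⊥ := by
    rw [← derivedSeries_succ, ← hn]; exact Nat.find_spec hex
  set A := derivedSeries G n with hAdef
  have hAn : A.Normal := by rw [hAdef]; infer_instance
  have hc : ∀ x ∈ A, ∀ y ∈ A, Commute x y := fun x hx y hy => by
    rw [Subgroup.commutator_eq_bot_iff_le_centralizer] at hA'
    exact (Subgroup.mem_centralizer_iff.1 (hA' hy) x hx)
  obtain ⟨q, hq, hqd⟩ := Nat.exists_prime_and_dvd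
    (mt Subgroup.card_eq_one.1 hA)
  have := Fact.mk hq
  obtain ⟨z, hz⟩ := exists_prime_orderOf_dvd_card' q hqd
  let N : Subgroup G :=
    { carrier := {x | x ∈ A ∧ x ^ q = 1}
      mul_mem' := fun {x y} hx hy => ⟨A.mul_mem hx.1 hy.1, by
        rw [(hc x hx.1 y hy.1).mul_pow, hx.2, hy.2, one_mul]⟩
      one_mem' := ⟨A.one_mem, one_pow q⟩
      inv_mem' := fun {x} hx => ⟨A.inv_mem hx.1, by rw [inv_pow, hx.2, inv_one]⟩ }
  refine ⟨q, N, hq, ⟨fun x hx g => ⟨hAn.conj_mem x hx.1 g, ?_⟩⟩, fun h => ?_, fun x => ⟨1, ?_⟩⟩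
  · rw [conj_pow, hx.2]; simp
  · have hzN : (z : G) ∈ N := ⟨z.2, by
      rw [← Subgroup.coe_pow, ← hz, pow_orderOf_eq_one, Subgroup.coe_one]⟩
    rw [h, Subgroup.mem_bot] at hzN
    have : z = 1 := Subtype.ext hzN
    rw [this, orderOf_one] at hz
    exact hq.one_lt.ne hz
  · rw [pow_one]; exact Subtype.ext x.2.2

/-- Hall: finite solvable groups have `p`-complements. -/
theorem Group.exists_isPComplement {p : ℕ} (hp : p.Prime) (G : Type*) [Group G] [Finite G]
    (hG : Group.IsSolvable G) :
    ∃ H : Subgroup G, ¬ p ∣ Nat.card H ∧ ∃ k, H.index = p ^ k := by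
  induction hn : Nat.card G using Nat.strong_induction_on generalizing G with
  | _ n ih =>
  rcases subsingleton_or_nontrivial G with _ | _
  · exact ⟨⊤, by simpa using hp.ne_one, 0, by simp⟩
  obtain ⟨q, N, hq, hNn, hNb, hNq⟩ := Group.exists_normal_isPGroup hG
  have hN1 : 1 < Nat.card N := Subgroup.one_lt_card_iff_ne_bot N |>.2 hNb
  have hcard := N.card_mul_index
  have hlt : Nat.card (G ⧸ N) < n := by
    rw [← Subgroup.index_eq_card, ← hn, ← hcard]
    exact lt_mul_of_one_lt_left (Nat.pos_of_ne_zero N.index_ne_zero_of_finite) hN1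
  obtain ⟨K, hK, k, hk⟩ := ih _ hlt (G ⧸ N) inferInstance rfl
  have hsurj := QuotientGroup.mk'_surjective N
  have hHi : (K.comap (QuotientGroup.mk' N)).index = p ^ k := by
    rw [Subgroup.index_comap_of_surjective _ hsurj, hk]
  have hHc : Nat.card (K.comap (QuotientGroup.mk' N)) = Nat.card N * Nat.card K := by
    have h1 := (K.comap (QuotientGroup.mk' N)).card_mul_index
    rw [hHi, ← hcard, N.index_eq_card, ← K.card_mul_index, hk, ← mul_assoc] at h1
    exact Nat.eq_of_mul_eq_mul_right (pow_pos hp.pos k) h1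
  have := Fact.mk hq
  obtain ⟨m, hm⟩ := hNq.exists_card_eq
  by_cases hqp : q = p
  · subst hqp
    by_cases htop : K.comap (QuotientGroup.mk' N) = ⊤
    · have hK' : K = ⊤ := by
        rw [← Subgroup.map_comap_eq_self_of_surjective hsurj K, htop,
          Subgroup.map_top_of_surjective _ hsurj]
      have hNi : ¬ q ∣ N.index := by
        rw [hK'] at hK; rwa [N.index_eq_card, ← Subgroup.card_top]
      have hco : Nat.Coprime (Nat.card N) N.index := by
        rw [hm]; exact ((Nat.Prime.coprime_iff_not_dvd hq).2 hNi).pow_left m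
      obtain ⟨C, hC⟩ := Subgroup.exists_right_complement'_of_coprime hco
      exact ⟨C, by rwa [← hC.symm.index_eq_card], m, by rw [hC.index_eq_card, hm]⟩
    · set H := K.comap (QuotientGroup.mk' N)
      have hHlt : Nat.card H < n := hn ▸ lt_of_le_of_ne H.card_le_card_group
        (mt (Subgroup.eq_top_of_card_eq H) htop)
      obtain ⟨S, hS, j, hj⟩ := ih _ hHlt H inferInstance rfl
      refine ⟨S.map H.subtype, ?_, j + k, ?_⟩
      · rwa [Subgroup.card_map_of_injective H.subtype_injective]
      · rw [Subgroup.index_map_subtype, hj, hHi, pow_add]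
  · refine ⟨_, ?_, k, hHi⟩
    rw [hHc, hm, hp.dvd_mul, not_or]
    exact ⟨fun h => hqp ((Nat.prime_dvd_prime_iff_eq hp hq).1 (hp.dvd_of_dvd_pow h)).symm, hK⟩

theorem Group.exists_prime_index (G : Type*) [Group G] [Finite G] [Nontrivial G]
    (hG : Group.IsSolvable G) : ∃ H : Subgroup G, H.index.Prime := by
  induction hn : Nat.card G using Nat.strong_induction_on generalizing G with
  | _ n ih =>
  by_cases hs : IsSimpleGroup G
  · let : CommGroup G := { mul_comm := IsSimpleGroup.comm_iff_isSolvable.2 hG }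
    exact ⟨⊥, by rw [Subgroup.index_bot]; exact IsSimpleGroup.prime_card⟩
  · obtain ⟨N, hNn, hNb, hNt⟩ : ∃ N : Subgroup G, N.Normal ∧ N ≠ ⊥ ∧ N ≠ ⊤ := by
      by_contra! h
      exact hs ⟨fun N hN => or_iff_not_imp_left.2 (h N hN)⟩
    have hlt : Nat.card (G ⧸ N) < n := by
      rw [← Subgroup.index_eq_card, ← hn, ← N.card_mul_index]
      exact lt_mul_of_one_lt_left (Nat.pos_of_ne_zero N.index_ne_zero_of_finite)
        (Subgroup.one_lt_card_iff_ne_bot N |>.2 hNb)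
    have : Nontrivial (G ⧸ N) := QuotientGroup.nontrivial_iff.2 hNt
    obtain ⟨K, hK⟩ := ih _ hlt (G ⧸ N) inferInstance rfl
    exact ⟨K.comap (QuotientGroup.mk' N), by
      rwa [Subgroup.index_comap_of_surjective _ (QuotientGroup.mk'_surjective N)]⟩

theorem IsSimpleGroup.eq_bot_of_isPGroup {G : Type*} [Group G] [Finite G] [IsSimpleGroup G]
    (hG : ¬ Group.IsSolvable G) {p : ℕ} (hp : p.Prime) {N : Subgroup G} (hN : N.Normal)
    (h : IsPGroup p N) : N = ⊥ := by
  refine hN.eq_bot_or_eq_top.resolve_right fun htop => hG ?_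
  have := Fact.mk hp
  subst htop
  have := (h.of_equiv Subgroup.topEquiv).isNilpotent
  infer_instance

theorem Sylow.exists_ne_normalizer_inf_not_isPGroup {G : Type*} [Group G] [Finite G] {q : ℕ}
    [Fact q.Prime] {P Q : Sylow q G} (hne : P ≠ Q) (hPQ : (P : Subgroup G) ⊓ Q ≠ ⊥) :
    ∃ (S : Sylow q G) (D : Subgroup G), D ≠ ⊥ ∧ D ≤ S ∧
      ¬ IsPGroup q (Subgroup.normalizer (D : Set G)) := by
  have : Nonempty {x : Sylow q G × Sylow q G // x.1 ≠ x.2} := ⟨⟨(P, Q), hne⟩⟩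
  obtain ⟨⟨⟨A, B⟩, hAB⟩, hmax⟩ := Finite.exists_max
    fun x : {x : Sylow q G × Sylow q G // x.1 ≠ x.2} =>
      Nat.card ((x.1.1 : Subgroup G) ⊓ x.1.2 : Subgroup G)
  replace hmax : ∀ C E : Sylow q G, C ≠ E → Nat.card ((C : Subgroup G) ⊓ E : Subgroup G) ≤
      Nat.card ((A : Subgroup G) ⊓ B : Subgroup G) := fun C E h => hmax ⟨(C, E), h⟩
  simp only [ne_eq] at hAB
  refine ⟨A, (A : Subgroup G) ⊓ B, ?_, inf_le_left, fun hN => ?_⟩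
  · rw [← Subgroup.one_lt_card_iff_ne_bot] at hPQ ⊢
    exact hPQ.trans_le (hmax P Q hne)
  obtain ⟨C, hC⟩ := hN.exists_le_sylow
  have key : ∀ X Y : Sylow q G, X ≠ Y → (X : Subgroup G) ⊓ Y = (A : Subgroup G) ⊓ B → C = X := by
    intro X Y hXY hD
    by_contra hCX
    set D := (A : Subgroup G) ⊓ B
    have hDX : D ≤ X := hD ▸ inf_le_left
    have hlt : D.subgroupOf X < ⊤ := by
      rw [lt_top_iff_ne_top, ne_eq, Subgroup.subgroupOf_eq_top]
      intro h
      exact hXY (Sylow.ext (X.is_maximal' Y.isPGroup' ((h.trans hD.ge).trans inf_le_right))).symm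
    have := X.isPGroup'.isNilpotent
    have hlt2 := Group.normalizerCondition_of_isNilpotent _ hlt
    rw [← Subgroup.subgroupOf_normalizer_eq hDX] at hlt2
    obtain ⟨x, hx, hx'⟩ := SetLike.exists_of_lt hlt2
    have hlt3 : D < (C : Subgroup G) ⊓ X := by
      refine lt_of_le_of_ne (le_inf (Subgroup.le_normalizer.trans hC) hDX) fun h => hx' ?_
      rw [Subgroup.mem_subgroupOf] at hx ⊢
      rw [h]
      exact ⟨hC hx, x.2⟩
    exact (Set.Finite.card_lt_card (Set.toFinite _) hlt3).not_ge (hmax C X hCX)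
  exact hAB ((key A B hAB rfl).symm.trans (key B A (Ne.symm hAB) (inf_comm _ _)))

theorem IsSimpleGroup.isSolvable_of_card_eq_prime_mul_pow {G : Type*} [Group G] [Finite G]
    [IsSimpleGroup G] {r q b : ℕ} (hr : r.Prime) (hq : q.Prime) (hrq : r ≠ q)
    (hc : Nat.card G = r * q ^ b) : Group.IsSolvable G := by
  by_contra hns
  have := Fact.mk hr
  have := Fact.mk hq
  have hrqb : ¬ r ∣ q ^ b := fun h => hrq ((Nat.prime_dvd_prime_iff_eq hr hq).1
    (hr.dvd_of_dvd_pow h))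
  have hcop : Nat.Coprime r (q ^ b) := (Nat.Prime.coprime_iff_not_dvd hr).2 hrqb
  have hPc : ∀ P : Sylow q G, Nat.card P = q ^ b := fun P => by
    rw [P.card_eq_multiplicity, hc, Nat.factorization_mul hr.ne_zero (pow_pos hq.pos b).ne']
    simp [hr.factorization, hq.factorization, hrq]
  have hRc : ∀ R : Sylow r G, Nat.card R = r := fun R => by
    rw [R.card_eq_multiplicity, hc, Nat.factorization_mul hr.ne_zero (pow_pos hq.pos b).ne']
    simp [hr.factorization, hq.factorization, hrq.symm]
  have hPi : ∀ P : Sylow q G, (P : Subgroup G).index = r := fun P => by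
    have := (P : Subgroup G).card_mul_index
    rw [hPc P, hc, mul_comm] at this
    exact Nat.eq_of_mul_eq_mul_right (pow_pos hq.pos b) this
  have hPn : ∀ P : Sylow q G, ¬ (P : Subgroup G).Normal := fun P hP => by
    have hb := IsSimpleGroup.eq_bot_of_isPGroup hns hq hP P.isPGroup'
    have h1 := hPi P
    rw [hb, Subgroup.index_bot] at h1
    have := (IsPGroup.of_card (p := r) (n := 1) (by rw [h1, pow_one]) : IsPGroup r G).isNilpotent
    exact hns inferInstance
  have hnum : Nat.card (Sylow q G) = r := by
    have P : Sylow q G := default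
    have h1 := P.card_dvd_index
    rw [hPi P, Nat.dvd_prime hr] at h1
    refine h1.resolve_left fun h1 => hPn P ?_
    have := (Nat.card_eq_one_iff_unique.1 h1).1
    exact P.normal_of_subsingleton
  have hTI : ∀ P Q : Sylow q G, P ≠ Q → (P : Subgroup G) ⊓ Q = ⊥ := by
    intro P Q hne
    by_contra hPQ
    obtain ⟨S, D, hD, hDS, hDn⟩ := Sylow.exists_ne_normalizer_inf_not_isPGroup hne hPQ
    have hcn := (Subgroup.normalizer (D : Set G)).card_mul_index
    have hri : ¬ r ∣ (Subgroup.normalizer (D : Set G)).index := by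
      intro h
      obtain ⟨c, hc'⟩ := h
      have h1 : Nat.card (Subgroup.normalizer (D : Set G)) * c = q ^ b := by
        apply Nat.eq_of_mul_eq_mul_left hr.pos
        rw [← hc, ← hcn, hc']; ring
      obtain ⟨k, -, hk⟩ := (Nat.dvd_prime_pow hq).1 (Dvd.intro _ h1)
      exact hDn (IsPGroup.of_card hk)
    have hco := (Nat.Prime.coprime_iff_not_dvd hr).2 hri
    rw [← hPi S] at hco
    have h1 := Subgroup.le_normalCore_of_coprime_index hco le_rfl hDS
    have h2 := IsSimpleGroup.eq_bot_of_isPGroup hns hq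
      (inferInstance : (S : Subgroup G).normalCore.Normal)
      (S.isPGroup'.to_le (Subgroup.normalCore_le _))
    exact hD (le_bot_iff.1 (h2 ▸ h1))
  have hdisj : ∀ (P : Sylow q G) (x : G), x ∈ P → x ^ r = 1 → x = 1 := by
    intro P x hx hxr
    have h1 : x ^ (q ^ b) = 1 := by
      rw [← hPc P]
      exact congrArg Subtype.val (pow_card_eq_one' (x := (⟨x, hx⟩ : P)))
    exact orderOf_eq_one_iff.1
      (Nat.eq_one_of_dvd_coprimes hcop (orderOf_dvd_of_pow_eq_one hxr)
        (orderOf_dvd_of_pow_eq_one h1))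
  have R : Sylow r G := default
  have hRp : ∀ x ∈ R, x ^ r = 1 := fun x hx => by
    have := congrArg Subtype.val (pow_card_eq_one' (x := (⟨x, hx⟩ : (R : Subgroup G))))
    rwa [hRc R] at this
  let f : (Σ P : Sylow q G, {x : P // x ≠ 1}) ⊕ R → G := Sum.elim (fun x => (x.2.1 : G)) (fun x => x)
  have hf1 : ∀ (P : Sylow q G) (x : {x : P // x ≠ 1}), (x.1 : G) ≠ 1 := fun P x h =>
    x.2 (Subtype.ext h)
  have hf : Function.Injective f := by
    rintro (⟨P, x⟩ | x) (⟨Q, y⟩ | y) h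
    · have h' : (x.1 : G) = (y.1 : G) := h
      have hPQ : P = Q := by
        by_contra hne
        have : (x.1 : G) ∈ (P : Subgroup G) ⊓ Q := ⟨x.1.2, h' ▸ y.1.2⟩
        rw [hTI P Q hne, Subgroup.mem_bot] at this
        exact hf1 P x this
      subst hPQ
      rw [Subtype.ext (Subtype.ext h')]
    · have h' : (x.1 : G) = (y : G) := h
      exact absurd (hdisj P _ x.1.2 (h' ▸ hRp y y.2)) (hf1 P x)
    · have h' : (x : G) = (y.1 : G) := h
      exact absurd (hdisj Q _ y.1.2 (h' ▸ hRp x x.2)) (hf1 Q y)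
    · exact congrArg Sum.inr (Subtype.ext h)
  have hfc : Nat.card G ≤ Nat.card ((Σ P : Sylow q G, {x : P // x ≠ 1}) ⊕ R) := by
    have := Fintype.ofFinite (Sylow q G)
    have h1 : ∀ P : Sylow q G, Nat.card {x : P // x ≠ 1} = q ^ b - 1 := fun P => by
      have := Set.ncard_compl ({1} : Set P)
      rwa [Set.ncard_singleton, hPc P] at this
    rw [Nat.card_sum, Nat.card_sigma, hRc R]
    simp only [h1]
    rw [Finset.sum_const, Finset.card_univ, ← Nat.card_eq_fintype_card, hnum, hc, smul_eq_mul]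
    obtain ⟨c, hc⟩ := Nat.exists_eq_succ_of_ne_zero (pow_pos hq.pos b).ne'
    rw [hc]; simp [mul_add]
  have hbij := hf.bijective_of_nat_card_le hfc
  have hRn : (R : Subgroup G).Normal := by
    refine ⟨fun x hx g => ?_⟩
    obtain ⟨(⟨P, y⟩ | y), hy⟩ := hbij.2 (g * x * g⁻¹)
    · have h' : (y.1 : G) = g * x * g⁻¹ := hy
      refine absurd (hdisj P _ y.1.2 ?_) (hf1 P y)
      rw [h', conj_pow, hRp x hx]; simp
    · have h' : (y : G) = g * x * g⁻¹ := hy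
      exact h' ▸ y.2
  have h1 := IsSimpleGroup.eq_bot_of_isPGroup hns hr hRn R.isPGroup'
  have h2 := hRc R
  rw [show Nat.card R = Nat.card (R : Subgroup G) from rfl, h1, Subgroup.card_bot] at h2
  exact hr.one_lt.ne h2

theorem Subgroup.exists_conj_le_of_isPGroup {G : Type*} [Group G] [Finite G] {q : ℕ}
    [Fact q.Prime] {N T : Subgroup G} (hN : IsPGroup q N) (hT : ¬ q ∣ T.index) :
    ∃ g : G, ∀ x ∈ N, g * x * g⁻¹ ∈ T := by
  obtain ⟨Q, hQ⟩ := hN.exists_le_sylow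
  have S : Sylow q T := default
  obtain ⟨P, hP⟩ := (S.isPGroup'.map T.subtype).exists_le_sylow
  have hPT : (P : Subgroup G) ≤ T := by
    have h1 : (S : Subgroup T).map T.subtype = P := by
      refine Subgroup.eq_of_le_of_card_ge hP ?_
      rw [Subgroup.card_subtype, P.card_eq_multiplicity, S.card_eq_multiplicity,
        ← T.card_mul_index, Nat.factorization_mul Nat.card_pos.ne'
          Subgroup.index_ne_zero_of_finite, Finsupp.add_apply,
        Nat.factorization_eq_zero_of_not_dvd hT, add_zero]
    exact h1 ▸ Subgroup.map_subtype_le _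
  obtain ⟨g, rfl⟩ := MulAction.exists_smul_eq G Q P
  refine ⟨g, fun x hx => hPT ?_⟩
  rw [Sylow.coe_subgroup_smul]
  exact Subgroup.smul_mem_pointwise_smul x (MulAut.conj g) _ (hQ hx)

theorem IsSimpleGroup.not_dvd_card_of_prime_index {G : Type*} [Group G] [Finite G]
    [IsSimpleGroup G] {M : Subgroup G} (hM : M.index.Prime) : ¬ M.index ∣ Nat.card M := by
  intro h
  have hcore : M.normalCore = ⊥ :=
    (inferInstance : M.normalCore.Normal).eq_bot_or_eq_top.resolve_right fun htop => by
      have : M = ⊤ := top_le_iff.1 (htop ▸ M.normalCore_le)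
      rw [this, Subgroup.index_top] at hM
      exact Nat.not_prime_one hM
  have h1 : Nat.card G ∣ M.index.factorial := by
    rw [← Subgroup.index_bot, ← hcore, Subgroup.normalCore_eq_ker, Subgroup.index_ker,
      Subgroup.index_eq_card, ← Nat.card_perm]
    exact Subgroup.card_subgroup_dvd_card _
  rw [← M.card_mul_index, ← Nat.mul_factorial_pred hM.ne_zero, mul_comm] at h1
  have h2 := (hM.dvd_factorial).1 (h.trans (Nat.dvd_of_mul_dvd_mul_left hM.pos h1))
  have := hM.pos
  omega

/-- A finite group whose proper subgroups are solvable, which has `p`-complements for all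
primes `p` and a subgroup of prime index, is solvable. -/
theorem Group.isSolvable_of_isPComplement_of_prime_index (G : Type*) [Group G] [Finite G]
    (hsub : ∀ H : Subgroup G, H ≠ ⊤ → Group.IsSolvable H)
    (hHall : ∀ p : ℕ, p.Prime → ∃ H : Subgroup G, ¬ p ∣ Nat.card H ∧ ∃ k, H.index = p ^ k)
    (hM : ∃ M : Subgroup G, M.index.Prime) : Group.IsSolvable G := by
  induction hn : Nat.card G using Nat.strong_induction_on generalizing G with
  | _ n ih =>
  rcases subsingleton_or_nontrivial G with _ | _
  · infer_instance
  obtain ⟨M, hM⟩ := hM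
  have hMtop : M ≠ ⊤ := fun h => by
    rw [h, Subgroup.index_top] at hM
    exact Nat.not_prime_one hM
  have hMs := hsub M hMtop
  by_cases hs : IsSimpleGroup G
  swap
  · obtain ⟨N, hNn, hNb, hNt⟩ : ∃ N : Subgroup G, N.Normal ∧ N ≠ ⊥ ∧ N ≠ ⊤ := by
      by_contra! h
      exact hs ⟨fun N hN => or_iff_not_imp_left.2 (h N hN)⟩
    refine (Group.isSolvable_iff_subgroup_quotient N).2 ⟨hsub N hNt, ?_⟩
    have hsurj := QuotientGroup.mk'_surjective N
    have hlt : Nat.card (G ⧸ N) < n := by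
      rw [← Subgroup.index_eq_card, ← hn, ← N.card_mul_index]
      exact lt_mul_of_one_lt_left (Nat.pos_of_ne_zero N.index_ne_zero_of_finite)
        (Subgroup.one_lt_card_iff_ne_bot N |>.2 hNb)
    rcases (Nat.dvd_prime hM).1 (M.index_map_dvd hsurj) with h1 | h1
    · rw [Subgroup.index_eq_one] at h1
      refine Group.isSolvable_of_surjective
        (f := (QuotientGroup.mk' N).comp M.subtype) fun y => ?_
      obtain ⟨x, hx, rfl⟩ := h1.ge (Subgroup.mem_top y)
      exact ⟨⟨x, hx⟩, rfl⟩
    · refine ih _ hlt (G ⧸ N) (fun H hH => ?_) (fun p hp => ?_) ⟨_, h1 ▸ hM⟩ rfl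
      · have := hsub (H.comap (QuotientGroup.mk' N)) fun h => hH <| by
          rw [← Subgroup.map_comap_eq_self_of_surjective hsurj H, h,
            Subgroup.map_top_of_surjective _ hsurj]
        exact Group.isSolvable_of_surjective
          ((QuotientGroup.mk' N).subgroupComap_surjective_of_surjective H hsurj)
      · obtain ⟨H, hH, k, hk⟩ := hHall p hp
        obtain ⟨j, -, hj⟩ := (Nat.dvd_prime_pow hp).1 (hk ▸ H.index_map_dvd hsurj)
        exact ⟨_, fun h => hH (h.trans (H.card_map_dvd _)), j, hj⟩
  by_contra hns
  have hrM := IsSimpleGroup.not_dvd_card_of_prime_index hM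
  have hcard := M.card_mul_index
  have : Nontrivial M := by
    rw [Subgroup.nontrivial_iff_ne_bot]
    rintro rfl
    have := Fact.mk hM
    have : IsPGroup (⊥ : Subgroup G).index (⊤ : Subgroup G) :=
      IsPGroup.of_card (n := 1) (by simp)
    exact top_ne_bot (IsSimpleGroup.eq_bot_of_isPGroup hns hM inferInstance this)
  obtain ⟨q, N, hq, hNn, hNb, hNq⟩ := Group.exists_normal_isPGroup hMs
  have := Fact.mk hq
  have hqM : q ∣ Nat.card M := by
    obtain ⟨m, hm⟩ := hNq.exists_card_eq
    have : m ≠ 0 := fun h => hNb (Subgroup.card_eq_one.1 (by rw [hm, h, pow_zero]))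
    exact ((dvd_pow_self q this).trans hm.symm.dvd).trans N.card_subgroup_dvd_card
  by_cases h3 : ∀ {t : ℕ}, t.Prime → t ∣ Nat.card M → t = q
  · refine hns (IsSimpleGroup.isSolvable_of_card_eq_prime_mul_pow hM hq
      (b := (Nat.card M).primeFactorsList.length) (fun h => hrM (h ▸ hqM)) ?_)
    rw [← Nat.eq_prime_pow_of_unique_prime_dvd Nat.card_pos.ne' h3, mul_comm, hcard]
  · push Not at h3
    obtain ⟨t, ht, htM, htq⟩ := h3
    have htr : t ≠ M.index := fun h => hrM (h ▸ htM)
    obtain ⟨T, hT, k, hk⟩ := hHall t ht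
    have hqT : ¬ q ∣ T.index := fun h => htq
      ((Nat.prime_dvd_prime_iff_eq hq ht).1 (hq.dvd_of_dvd_pow (hk ▸ h))).symm
    obtain ⟨g, hg⟩ := Subgroup.exists_conj_le_of_isPGroup (hNq.map M.subtype) hqT
    have hco : Nat.Coprime (T.comap (MulAut.conj g).toMonoidHom).index M.index := by
      rw [Subgroup.index_comap_of_surjective _ (MulAut.conj g).surjective, hk]
      exact ((Nat.coprime_primes ht hM).2 htr).pow_left k
    have hle := Subgroup.le_normalCore_of_coprime_index (N := N.map M.subtype) hco
      (fun m hm => Subgroup.le_normalizer_map M.subtype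
        ⟨⟨m, hm⟩, by rw [Subgroup.normalizer_eq_top]; trivial, rfl⟩)
      fun x hx => hg x hx
    rcases (inferInstance : ((T.comap (MulAut.conj g).toMonoidHom).normalCore).Normal
      ).eq_bot_or_eq_top with h | h
    · rw [h, le_bot_iff] at hle
      exact hNb ((Subgroup.map_eq_bot_iff_of_injective _ M.subtype_injective).1 hle)
    · have h2 : T.comap (MulAut.conj g).toMonoidHom = ⊤ :=
        top_le_iff.1 (h ▸ Subgroup.normalCore_le _)
      have h4 : T.index = 1 := by
        rw [← Subgroup.index_comap_of_surjective T (f := (MulAut.conj g).toMonoidHom)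
          (MulAut.conj g).surjective, h2, Subgroup.index_top]
      rw [Subgroup.index_eq_one] at h4
      rw [h4, Subgroup.card_top] at hT
      exact hT (htM.trans M.card_subgroup_dvd_card)

section IsoClasses

variable {G₁ G₂ : Type*} [Group G₁] [Group G₂]

theorem IsoCls_eq_iff {H K : Subgroup G₁} : IsoCls H = IsoCls K ↔ Nonempty (H ≃* K) :=
  Quotient.eq (r := isoSetoid G₁)

theorem IsoCls_le_iff {H K : Subgroup G₁} :
    IsoCls H ≤ IsoCls K ↔ ∃ L ≤ K, IsoCls L = IsoCls H := by
  constructor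
  · rintro ⟨A, B, hA, hB, hAB⟩
    obtain ⟨e⟩ := IsoCls_eq_iff.1 hB
    refine ⟨((A.subgroupOf B).map e.toMonoidHom).map K.subtype, Subgroup.map_subtype_le _, ?_⟩
    rw [← hA, IsoCls_eq_iff]
    exact ⟨((Subgroup.equivMapOfInjective _ K.subtype K.subtype_injective).symm.trans
      (Subgroup.equivMapOfInjective _ e.toMonoidHom e.injective).symm).trans
      (Subgroup.subgroupOfEquivOfLe hAB)⟩
  · rintro ⟨L, hL, h⟩
    exact ⟨L, K, h, rfl, hL⟩

theorem card_eq_of_IsoCls_eq {H K : Subgroup G₁} (h : IsoCls H = IsoCls K) :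
    Nat.card H = Nat.card K := by
  obtain ⟨e⟩ := IsoCls_eq_iff.1 h
  exact Nat.card_congr e.toEquiv

theorem IsoCls_eq_of_card_eq_prime {H K : Subgroup G₁} {p : ℕ} (hp : p.Prime)
    (hH : Nat.card H = p) (hK : Nat.card K = p) : IsoCls H = IsoCls K := by
  have := Fact.mk hp
  exact IsoCls_eq_iff.2 ⟨mulEquivOfPrimeCardEq hH hK⟩

theorem Subgroup.exists_le_card_eq_pow [Finite G₁] {H : Subgroup G₁} {p n : ℕ} (hp : p.Prime)
    (h : p ^ n ∣ Nat.card H) : ∃ L ≤ H, Nat.card L = p ^ n := by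
  have := Fact.mk hp
  obtain ⟨L, hL⟩ := Sylow.exists_subgroup_card_pow_prime p h
  exact ⟨L.map H.subtype, Subgroup.map_subtype_le _, by rw [Subgroup.card_subtype, hL]⟩

theorem Subgroup.exists_le_card_eq_prime [Finite G₁] {H : Subgroup G₁} {p : ℕ} (hp : p.Prime)
    (h : p ∣ Nat.card H) : ∃ L ≤ H, Nat.card L = p := by
  simpa using Subgroup.exists_le_card_eq_pow (n := 1) hp (by simpa using h)

/-- The subgroups `H` and `K` have corresponding isomorphism classes under `φ`. -/
def IsoCorr (φ : IsoClasses G₁ ≃o IsoClasses G₂) (H : Subgroup G₁) (K : Subgroup G₂) : Prop :=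
  φ (IsoCls H) = IsoCls K

namespace IsoCorr

variable {φ : IsoClasses G₁ ≃o IsoClasses G₂}

theorem symm {H : Subgroup G₁} {K : Subgroup G₂} (h : IsoCorr φ H K) : IsoCorr φ.symm K H := by
  rw [IsoCorr, ← h, OrderIso.symm_apply_apply]

theorem IsoCls_eq_left {H H' : Subgroup G₁} {K K' : Subgroup G₂} (h : IsoCorr φ H K)
    (h' : IsoCorr φ H' K') (hK : IsoCls K = IsoCls K') : IsoCls H = IsoCls H' :=
  φ.injective (Eq.trans h (hK.trans (Eq.symm h')))

theorem IsoCls_eq_right {H H' : Subgroup G₁} {K K' : Subgroup G₂} (h : IsoCorr φ H K)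
    (h' : IsoCorr φ H' K') (hH : IsoCls H = IsoCls H') : IsoCls K = IsoCls K' :=
  h.symm.IsoCls_eq_left h'.symm hH

theorem exists_right (φ : IsoClasses G₁ ≃o IsoClasses G₂) (H : Subgroup G₁) :
    ∃ K, IsoCorr φ H K := by
  obtain ⟨K, hK⟩ := Quotient.exists_rep (φ (IsoCls H))
  exact ⟨K, hK.symm⟩

theorem exists_le {H S : Subgroup G₁} {K : Subgroup G₂} (h : IsoCorr φ H K) (hS : S ≤ H) :
    ∃ T ≤ K, IsoCorr φ S T := by
  obtain ⟨T, hT⟩ := exists_right φ S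
  have : IsoCls T ≤ IsoCls K := by
    rw [← hT, ← h, φ.le_iff_le]
    exact ⟨S, H, rfl, rfl, hS⟩
  obtain ⟨L, hL, hLT⟩ := IsoCls_le_iff.1 this
  exact ⟨L, hL, hT.trans hLT.symm⟩

theorem exists_le_left {H : Subgroup G₁} {K T : Subgroup G₂} (h : IsoCorr φ H K) (hT : T ≤ K) :
    ∃ S ≤ H, IsoCorr φ S T := by
  obtain ⟨S, hS, hST⟩ := h.symm.exists_le hT
  exact ⟨S, hS, hST.symm⟩

theorem eq_bot {K : Subgroup G₂} (h : IsoCorr φ ⊥ K) : K = ⊥ := by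
  obtain ⟨S, hS, hST⟩ := h.exists_le_left (bot_le : ⊥ ≤ K)
  rw [le_bot_iff.1 hS] at hST
  have := card_eq_of_IsoCls_eq (h.IsoCls_eq_right hST rfl)
  rwa [Subgroup.card_bot, Subgroup.card_eq_one] at this

theorem card_eq_right {P P' : Subgroup G₁} {Q Q' : Subgroup G₂} (h : IsoCorr φ P Q)
    (h' : IsoCorr φ P' Q') (hP : (Nat.card P).Prime) (hPP : Nat.card P = Nat.card P') :
    Nat.card Q = Nat.card Q' :=
  card_eq_of_IsoCls_eq (h.IsoCls_eq_right h' (IsoCls_eq_of_card_eq_prime hP rfl hPP.symm))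

variable [Finite G₁] [Finite G₂]

theorem prime_card {H : Subgroup G₁} {K : Subgroup G₂} (h : IsoCorr φ H K)
    (hH : (Nat.card H).Prime) : (Nat.card K).Prime := by
  have hK : Nat.card K ≠ 1 := fun hK => by
    rw [Subgroup.card_eq_one] at hK
    subst hK
    rw [h.symm.eq_bot, Subgroup.card_bot] at hH
    exact Nat.not_prime_one hH
  obtain ⟨q, hq, hqK⟩ := Nat.exists_prime_and_dvd hK
  obtain ⟨Q, hQK, hQ⟩ := Subgroup.exists_le_card_eq_prime hq hqK
  obtain ⟨S, hSH, hS⟩ := h.exists_le_left hQK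
  rcases (Nat.dvd_prime hH).1 (Subgroup.card_dvd_of_le hSH) with h1 | h1
  · rw [Subgroup.card_eq_one] at h1
    subst h1
    rw [hS.eq_bot, Subgroup.card_bot] at hQ
    exact absurd hQ hq.one_lt.ne
  · rw [Subgroup.eq_of_le_of_card_ge hSH h1.ge] at hS
    rwa [card_eq_of_IsoCls_eq (h.IsoCls_eq_right hS rfl), hQ]

theorem exists_card_eq_pow {A P : Subgroup G₁} {B Q : Subgroup G₂} (hAB : IsoCorr φ A B)
    (hPQ : IsoCorr φ P Q) (hP : (Nat.card P).Prime) {n : ℕ} (hA : Nat.card A = Nat.card P ^ n) :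
    ∃ m, n ≤ m ∧ Nat.card B = Nat.card Q ^ m := by
  induction n generalizing A B with
  | zero =>
    rw [pow_zero, Subgroup.card_eq_one] at hA
    subst hA
    exact ⟨0, le_rfl, by rw [hAB.eq_bot, Subgroup.card_bot, pow_zero]⟩
  | succ n ih =>
    obtain ⟨A', hA', hA'c⟩ := Subgroup.exists_le_card_eq_pow (n := n) hP
      (hA ▸ pow_dvd_pow _ n.le_succ)
    obtain ⟨B', hB', hAB'⟩ := hAB.exists_le hA'
    obtain ⟨m', hm', hB'c⟩ := ih hAB' hA'c
    have hB : Nat.card B = Nat.card Q ^ (Nat.card B).primeFactorsList.length := by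
      refine Nat.eq_prime_pow_of_unique_prime_dvd Nat.card_pos.ne' fun {r} hr hrB => ?_
      obtain ⟨R, hRB, rfl⟩ := Subgroup.exists_le_card_eq_prime hr hrB
      obtain ⟨S, hSA, hSR⟩ := hAB.exists_le_left hRB
      have hS := hSR.symm.prime_card hr
      refine hSR.card_eq_right hPQ hS ((Nat.prime_dvd_prime_iff_eq hS hP).1 ?_)
      exact hS.dvd_of_dvd_pow (hA ▸ Subgroup.card_dvd_of_le hSA)
    refine ⟨_, ?_, hB⟩
    have hne : Nat.card B' ≠ Nat.card B := fun h => by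
      rw [Subgroup.eq_of_le_of_card_ge hB' h.ge] at hAB'
      have := card_eq_of_IsoCls_eq (hAB.IsoCls_eq_left hAB' rfl)
      rw [hA, hA'c] at this
      exact absurd (Nat.pow_right_injective hP.two_le this) n.succ_ne_self
    have hlt := lt_of_le_of_ne (Subgroup.card_le_of_le hB') hne
    rw [hB, hB'c] at hlt
    exact (hm'.trans_lt ((Nat.pow_lt_pow_iff_right (hPQ.prime_card hP).one_lt).1 hlt))

theorem pow_dvd_card {H P : Subgroup G₁} {K Q : Subgroup G₂} (h : IsoCorr φ H K)
    (hPQ : IsoCorr φ P Q) (hP : (Nat.card P).Prime) {n : ℕ} (hn : Nat.card P ^ n ∣ Nat.card H) :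
    Nat.card Q ^ n ∣ Nat.card K := by
  obtain ⟨A, hA, hAc⟩ := Subgroup.exists_le_card_eq_pow hP hn
  obtain ⟨B, hB, hAB⟩ := h.exists_le hA
  obtain ⟨m, hm, hBc⟩ := hAB.exists_card_eq_pow hPQ hP hAc
  exact (pow_dvd_pow _ hm).trans (hBc ▸ Subgroup.card_dvd_of_le hB)

theorem factorization_card {H P : Subgroup G₁} {K Q : Subgroup G₂} (h : IsoCorr φ H K)
    (hPQ : IsoCorr φ P Q) (hP : (Nat.card P).Prime) :
    (Nat.card H).factorization (Nat.card P) = (Nat.card K).factorization (Nat.card Q) := by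
  have hQ := hPQ.prime_card hP
  apply le_antisymm
  · rw [← hQ.pow_dvd_iff_le_factorization Nat.card_pos.ne']
    exact h.pow_dvd_card hPQ hP (Nat.ordProj_dvd _ _)
  · rw [← hP.pow_dvd_iff_le_factorization Nat.card_pos.ne']
    exact h.symm.pow_dvd_card hPQ.symm hQ (Nat.ordProj_dvd _ _)

theorem relIndex_eq_pow {H S P : Subgroup G₁} {K T Q : Subgroup G₂} (h : IsoCorr φ H K)
    (hST : IsoCorr φ S T) (hSH : S ≤ H) (hTK : T ≤ K) (hPQ : IsoCorr φ P Q)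
    (hP : (Nat.card P).Prime) {k : ℕ} (hk : S.relIndex H = Nat.card P ^ k) :
    T.relIndex K = Nat.card Q ^ k := by
  have hQ := hPQ.prime_card hP
  have hS0 : S.relIndex H ≠ 0 := Subgroup.index_ne_zero_of_finite
  have hT0 : T.relIndex K ≠ 0 := Subgroup.index_ne_zero_of_finite
  have hS : Nat.card S * S.relIndex H = Nat.card H := by
    rw [← Subgroup.relIndex_bot_left, Subgroup.relIndex_mul_relIndex _ _ _ bot_le hSH,
      Subgroup.relIndex_bot_left]
  have hT : Nat.card T * T.relIndex K = Nat.card K := by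
    rw [← Subgroup.relIndex_bot_left, Subgroup.relIndex_mul_relIndex _ _ _ bot_le hTK,
      Subgroup.relIndex_bot_left]
  have key : ∀ {P' : Subgroup G₁} {Q' : Subgroup G₂}, IsoCorr φ P' Q' → (Nat.card P').Prime →
      (S.relIndex H).factorization (Nat.card P') = (T.relIndex K).factorization (Nat.card Q') := by
    intro P' Q' hPQ' hP'
    have h1 := h.factorization_card hPQ' hP'
    rw [← hS, ← hT, Nat.factorization_mul Nat.card_pos.ne' hS0,
      Nat.factorization_mul Nat.card_pos.ne' hT0, Finsupp.add_apply, Finsupp.add_apply,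
      hST.factorization_card hPQ' hP'] at h1
    exact Nat.add_left_cancel h1
  have hpow : T.relIndex K = Nat.card Q ^ (T.relIndex K).primeFactorsList.length := by
    refine Nat.eq_prime_pow_of_unique_prime_dvd hT0 fun {d} hd hdT => ?_
    obtain ⟨D, hDK, rfl⟩ := Subgroup.exists_le_card_eq_prime (H := K) hd
      (hdT.trans (hT ▸ dvd_mul_left _ _))
    obtain ⟨E, -, hED⟩ := h.exists_le_left hDK
    have hE := hED.symm.prime_card hd
    refine hED.card_eq_right hPQ hE ((Nat.prime_dvd_prime_iff_eq hE hP).1 ?_)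
    refine hE.dvd_of_dvd_pow (n := k) (hk ▸ Nat.dvd_of_factorization_pos ?_)
    rw [key hED hE]
    exact (hd.factorization_pos_of_dvd hT0 hdT).ne'
  have h1 := key hPQ hP
  rw [hk, hpow, hP.factorization_pow, hQ.factorization_pow, Finsupp.single_eq_same,
    Finsupp.single_eq_same] at h1
  rw [hpow, ← h1]

theorem isSolvable {H : Subgroup G₁} {K : Subgroup G₂} (h : IsoCorr φ H K)
    (hH : Group.IsSolvable H) : Group.IsSolvable K := by
  induction hn : Nat.card K using Nat.strong_induction_on generalizing H K with
  | _ n ih =>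
  rcases subsingleton_or_nontrivial K with _ | hKn
  · infer_instance
  refine Group.isSolvable_of_isPComplement_of_prime_index K (fun L hL => ?_) (fun s hs => ?_) ?_
  · have e := Subgroup.equivMapOfInjective L K.subtype K.subtype_injective
    obtain ⟨S, hSH, hS⟩ := h.exists_le_left (Subgroup.map_subtype_le L)
    have : Group.IsSolvable S :=
      Group.isSolvable_of_isSolvable_injective (Subgroup.inclusion_injective hSH)
    have hlt : Nat.card (L.map K.subtype) < n := by
      rw [Subgroup.card_subtype, ← hn]
      exact lt_of_le_of_ne L.card_le_card_group (mt (Subgroup.eq_top_of_card_eq L) hL)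
    have := ih _ hlt hS this rfl
    exact Group.isSolvable_of_isSolvable_injective (f := e.toMonoidHom) e.injective
  · by_cases hsK : s ∣ Nat.card K
    · obtain ⟨Q, hQK, rfl⟩ := Subgroup.exists_le_card_eq_prime hs hsK
      obtain ⟨P, hPH, hPQ⟩ := h.exists_le_left hQK
      have hP := hPQ.symm.prime_card hs
      obtain ⟨S, hS, k, hk⟩ := Group.exists_isPComplement hP H hH
      obtain ⟨T, hTK, hST⟩ := h.exists_le (Subgroup.map_subtype_le S)
      refine ⟨T.subgroupOf K, fun hd => hS ?_, k,
        h.relIndex_eq_pow hST (Subgroup.map_subtype_le S) hTK hPQ hP ?_⟩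
      · rw [Nat.card_congr (Subgroup.subgroupOfEquivOfLe hTK).toEquiv] at hd
        have := hST.symm.pow_dvd_card (n := 1) hPQ.symm hs (by rwa [pow_one])
        rwa [pow_one, Subgroup.card_subtype] at this
      · rw [Subgroup.relIndex, Subgroup.subgroupOf,
          Subgroup.comap_map_eq_self_of_injective H.subtype_injective, hk]
    · exact ⟨⊤, by rwa [Subgroup.card_top], 0, by simp⟩
  · have : Nontrivial H := by
      rw [Subgroup.nontrivial_iff_ne_bot] at hKn ⊢
      rintro rfl
      exact hKn h.eq_bot
    obtain ⟨M, hM⟩ := Group.exists_prime_index H hH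
    obtain ⟨P, hPH, hP⟩ := Subgroup.exists_le_card_eq_prime (H := H) hM M.index_dvd_card
    obtain ⟨Q, hQK, hPQ⟩ := h.exists_le hPH
    obtain ⟨T, hTK, hST⟩ := h.exists_le (Subgroup.map_subtype_le M)
    have hP' : (Nat.card P).Prime := hP ▸ hM
    refine ⟨T.subgroupOf K, ?_⟩
    have := h.relIndex_eq_pow (k := 1) hST (Subgroup.map_subtype_le M) hTK hPQ hP' (by
      rw [Subgroup.relIndex, Subgroup.subgroupOf,
        Subgroup.comap_map_eq_self_of_injective H.subtype_injective, hP, pow_one])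
    rw [Subgroup.relIndex, pow_one] at this
    rw [this]
    exact hPQ.prime_card hP'

end IsoCorr

end IsoClasses

/-- If `IsoClasses G₁` and `IsoClasses G₂` are order isomorphic and
`G₁` is solvable, then `G₂` is solvable. -/
theorem isSolvable_of_isoClasses_orderIso
    (G₁ : Type*) [Group G₁] [Finite G₁] (G₂ : Type*) [Group G₂] [Finite G₂]
    (h : Nonempty (IsoClasses G₁ ≃o IsoClasses G₂)) (hs : IsSolvable G₁) :
    IsSolvable G₂ := by
  obtain ⟨φ⟩ := h
  obtain ⟨H, hH⟩ := IsoCorr.exists_right φ.symm (⊤ : Subgroup G₂)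
  have hG : Group.IsSolvable G₁ := hs
  have := hH.symm.isSolvable (inferInstance : Group.IsSolvable H)
  exact Group.isSolvable_of_surjective (f := (Subgroup.topEquiv (G := G₂)).toMonoidHom)
    Subgroup.topEquiv.surjective
end
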